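/- There is no positive Legendrian loop in J¹(S¹) based at the 1-jet extension of a function. Precisely: let F: ℝ → ℝ be smooth and 1-periodic, and suppose q, p, z: [0,1]×ℝ → ℝ are smooth functions such that: (a) q(t,x+1) = q(t,x)+1 and p(t,x+1) = p(t,x), z(t,x+1) = z(t,x) for all t,x; (b) for each t, the map ι_t: x ↦ (q(t,x), p(t,x), z(t,x)) is an immersion ((∂_x q, ∂_x p, ∂_x z)(t,x) ≠ (0,0,0)) which is injective modulo the ℤ-action (if ι_t(x) = k•ι_t(y) for some integer k, then x − y ∈ ℤ); (c) each ι_t is Legendrian: ∂_x z(t,x) = p(t,x)·∂_x q(t,x) for all t,x; (d) the isotopy is positive: ∂_t z(t,x) − p(t,x)·∂_t q(t,x) > 0 for all t,x; (e) ι_0(x) = (x, F'(x), F(x)) for all x. Then the images cannot close up: it is impossible that the image of ι_1 coincides, modulo the ℤ-action, with the image of ι_0 (i.e., that {k•ι_1(x) : x ∈ ℝ, k ∈ ℤ} = {k•(y, F'(y), F(y)) : y ∈ ℝ, k ∈ ℤ}). -/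

import Mathlib

open Real

noncomputable section

open MeasureTheory Metric Set Filter Topology

section Brouwer

variable {E : Type*} [NormedAddCommGroup E] [InnerProductSpace ℝ E] [FiniteDimensional ℝ E]

/-- `t ↦ det (1 + t A)` is a polynomial of degree at most `dim E`. -/
lemma exists_polynomial_det_one_add_smul (A : E →L[ℝ] E) :
    ∃ P : Polynomial ℝ, P.natDegree ≤ Module.finrank ℝ E ∧
      ∀ t : ℝ, P.eval t = (ContinuousLinearMap.id ℝ E + t • A).det := by
  classical
  let b := Module.finBasis ℝ E
  let M := LinearMap.toMatrix b b (A : E →ₗ[ℝ] E)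
  refine ⟨Matrix.det ((Polynomial.X : Polynomial ℝ) • M.map Polynomial.C +
    (1 : Matrix (Fin (Module.finrank ℝ E)) (Fin (Module.finrank ℝ E)) ℝ).map Polynomial.C), ?_, ?_⟩
  · simpa using Polynomial.natDegree_det_X_add_C_le M 1
  · intro t
    have h : (ContinuousLinearMap.id ℝ E + t • A).det = (1 + t • M).det := by
      rw [ContinuousLinearMap.det, ← LinearMap.det_toMatrix b]
      congr 1
      simp [M]
    rw [h, ← Polynomial.coe_evalRingHom, RingHom.map_det]
    congr 1
    ext i j
    simp [Matrix.one_apply]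
    split_ifs <;> simp <;> ring

lemma det_id_add_smul_pos {A : E →L[ℝ] E} {K t : ℝ} (hA : ‖A‖ ≤ K) (ht : 0 ≤ t)
    (htK : t * K < 1) : 0 < (ContinuousLinearMap.id ℝ E + t • A).det := by
  have hne : ∀ s ∈ Icc 0 t, (ContinuousLinearMap.id ℝ E + s • A).det ≠ 0 := by
    intro s hs h0
    have hu : IsUnit (ContinuousLinearMap.id ℝ E + s • A) := by
      have : ‖-(s • A)‖ < 1 := by
        rw [norm_neg, norm_smul, Real.norm_eq_abs, abs_of_nonneg hs.1]
        have hK : 0 ≤ K := (norm_nonneg A).trans hA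
        calc s * ‖A‖ ≤ t * K := mul_le_mul hs.2 hA (norm_nonneg _) ht
          _ < 1 := htK
      have h := isUnit_one_sub_of_norm_lt_one this
      rw [sub_neg_eq_add] at h
      exact h
    obtain ⟨u, hu⟩ := hu
    have h1 : LinearMap.det (((u⁻¹ : (E →L[ℝ] E)ˣ) : E →L[ℝ] E) : E →ₗ[ℝ] E) *
        LinearMap.det ((u : E →L[ℝ] E) : E →ₗ[ℝ] E) = 1 := by
      rw [← LinearMap.det_comp]
      have : (((u⁻¹ : (E →L[ℝ] E)ˣ) : E →L[ℝ] E) : E →ₗ[ℝ] E) ∘ₗ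
          ((u : E →L[ℝ] E) : E →ₗ[ℝ] E) = LinearMap.id := by
        have h := u.inv_mul
        ext x
        exact DFunLike.congr_fun h x
      rw [this]
      exact LinearMap.det_id
    rw [hu] at h1
    rw [ContinuousLinearMap.det] at h0
    rw [h0] at h1
    simp at h1
  by_contra hneg
  push Not at hneg
  have hc : ContinuousOn (fun s : ℝ => (ContinuousLinearMap.id ℝ E + s • A).det) (Icc 0 t) := by
    apply Continuous.continuousOn
    exact ContinuousLinearMap.continuous_det.comp (by fun_prop)
  have h0 : (ContinuousLinearMap.id ℝ E + (0 : ℝ) • A).det = 1 := by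
    simp [ContinuousLinearMap.det]
  obtain ⟨s, hs, hs0⟩ := intermediate_value_Icc' ht hc ⟨hneg, by rw [h0]; norm_num⟩
  exact hne s hs hs0

lemma injective_and_surjective_of_lipschitz_lt_one {u : E → E} {K t : ℝ}
    (hu : ∀ x y, ‖u x - u y‖ ≤ K * ‖x - y‖) (ht : 0 ≤ t) (htK : t * K < 1) :
    Function.Bijective (fun x => x + t • u x) := by
  constructor
  · intro x y hxy
    simp only at hxy
    have h1 : x - y = t • (u y - u x) := by
      rw [smul_sub, sub_eq_sub_iff_add_eq_add, hxy, add_comm]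
    have h2 : ‖x - y‖ ≤ t * K * ‖x - y‖ := by
      conv_lhs => rw [h1]
      rw [norm_smul, Real.norm_eq_abs, abs_of_nonneg ht, norm_sub_rev, mul_assoc]
      exact mul_le_mul_of_nonneg_left (hu x y) ht
    have h3 : ‖x - y‖ = 0 := by
      by_contra hne
      have : 0 < ‖x - y‖ := lt_of_le_of_ne (norm_nonneg _) (Ne.symm hne)
      nlinarith
    exact sub_eq_zero.1 (norm_eq_zero.1 h3)
  · intro y
    have hL : LipschitzWith (Real.toNNReal (t * K)) (fun x => y - t • u x) := by
      apply LipschitzWith.of_dist_le_mul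
      intro a b
      rw [dist_eq_norm, dist_eq_norm]
      have : y - t • u a - (y - t • u b) = t • (u b - u a) := by
        rw [smul_sub]; abel
      rw [this, norm_smul, Real.norm_eq_abs, abs_of_nonneg ht, norm_sub_rev]
      calc t * ‖u a - u b‖ ≤ t * (K * ‖a - b‖) := mul_le_mul_of_nonneg_left (hu a b) ht
        _ = (t * K) * ‖a - b‖ := by ring
        _ ≤ _ := by gcongr; exact Real.le_coe_toNNReal _
    have hc : ContractingWith (Real.toNNReal (t * K)) (fun x => y - t • u x) := by
      refine ⟨?_, hL⟩
      rw [← NNReal.coe_lt_coe, Real.coe_toNNReal', NNReal.coe_one]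
      exact max_lt htK one_pos
    refine ⟨ContractingWith.fixedPoint _ hc, ?_⟩
    have := hc.fixedPoint_isFixedPt
    unfold Function.IsFixedPt at this
    simp only at this ⊢
    nth_rewrite 1 [← this]
    abel

section Measure

variable [MeasurableSpace E] [BorelSpace E]

/-- A `C¹` map equal to the identity outside a ball has mean Jacobian determinant `1` there. -/
lemma integral_det_fderiv_of_eq_id {f : E → E} (hf : ContDiff ℝ 1 f) {R : ℝ}
    (hR : ∀ x, R ≤ ‖x‖ → f x = x) :
    ∫ x in ball (0 : E) R, (fderiv ℝ f x).det = volume.real (ball (0 : E) R) := by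
  classical
  set u : E → E := fun x => f x - x with hu
  have huC : ContDiff ℝ 1 u := hf.sub contDiff_id
  have hsupp : HasCompactSupport u := by
    refine HasCompactSupport.intro (isCompact_closedBall (0 : E) R) ?_
    intro x hx
    simp only [mem_closedBall, dist_zero_right, not_le] at hx
    simp [hu, hR x hx.le]
  obtain ⟨K, hK⟩ := ContDiff.lipschitzWith_of_hasCompactSupport hsupp huC one_ne_zero
  have hK' : ∀ x y, ‖u x - u y‖ ≤ K * ‖x - y‖ := fun x y => by
    simpa [dist_eq_norm] using hK.dist_le_mul x y
  have hdu : ∀ x, ‖fderiv ℝ u x‖ ≤ K := fun x => norm_fderiv_le_of_lipschitz ℝ hK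
  have hudiff : ∀ x, HasFDerivAt u (fderiv ℝ u x) x := fun x =>
    (huC.differentiable one_ne_zero x).hasFDerivAt
  have hsmall : ∀ t : ℝ, 0 ≤ t → t * K < 1 →
      ∫ x in ball (0 : E) R, (ContinuousLinearMap.id ℝ E + t • fderiv ℝ u x).det
        = volume.real (ball (0 : E) R) := by
    intro t ht htK
    obtain ⟨hinj, hsurj⟩ := injective_and_surjective_of_lipschitz_lt_one hK' ht htK
    have himg : (fun x => x + t • u x) '' ball (0 : E) R = ball (0 : E) R := by
      have hout : ∀ x, x ∉ ball (0 : E) R → x + t • u x = x := by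
        intro x hx
        simp only [mem_ball, dist_zero_right, not_lt] at hx
        simp [hu, hR x hx]
      ext y
      constructor
      · rintro ⟨x, hx, rfl⟩
        by_contra hy
        have := hinj (hout _ hy)
        simp only at this hy
        rw [this] at hy
        exact hy hx
      · intro hy
        obtain ⟨x, hx⟩ := hsurj y
        refine ⟨x, ?_, hx⟩
        by_contra hxb
        simp only at hx
        rw [hout x hxb] at hx
        exact hxb (hx ▸ hy)
    have key := integral_image_eq_integral_abs_det_fderiv_smul (volume : Measure E)
      (s := ball (0 : E) R) (f := fun x => x + t • u x)
      (f' := fun x => ContinuousLinearMap.id ℝ E + t • fderiv ℝ u x) measurableSet_ball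
      (fun x _ => ((hasFDerivAt_id x).add ((hudiff x).const_smul t)).hasFDerivWithinAt)
      hinj.injOn (fun _ => (1 : ℝ))
    rw [himg] at key
    simp only [smul_eq_mul, mul_one, integral_const, MeasurableSet.univ, measureReal_restrict_apply,
      univ_inter] at key
    rw [key]
    refine integral_congr_ae (Eventually.of_forall fun x => ?_)
    simp only
    rw [abs_of_pos (det_id_add_smul_pos (hdu x) ht htK)]
  set n := Module.finrank ℝ E
  set v : ℕ → ℝ := fun j => (j : ℝ) / ((n + 1) * (K + 1)) with hv
  have hKpos : (0 : ℝ) < (n + 1) * (K + 1) := by positivity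
  have hvinj : InjOn v (Finset.range (n + 1) : Finset ℕ) := by
    intro a _ b _ hab
    simp only [hv] at hab
    rw [div_left_inj' hKpos.ne'] at hab
    exact_mod_cast hab
  have hvs : ∀ j ∈ Finset.range (n + 1), 0 ≤ v j ∧ v j * K < 1 := by
    intro j hj
    have hj' : (j : ℝ) < n + 1 := by exact_mod_cast Finset.mem_range.1 hj
    refine ⟨by positivity, ?_⟩
    simp only [hv]
    rw [div_mul_eq_mul_div, div_lt_one hKpos]
    have : (0 : ℝ) ≤ K := K.2
    nlinarith [(Nat.cast_nonneg j : (0 : ℝ) ≤ j)]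
  have hdet : ∀ x, (fderiv ℝ f x).det = ∑ j ∈ Finset.range (n + 1),
      (Lagrange.basis (Finset.range (n + 1)) v j).eval 1 *
        (ContinuousLinearMap.id ℝ E + v j • fderiv ℝ u x).det := by
    intro x
    obtain ⟨P, hPdeg, hP⟩ := exists_polynomial_det_one_add_smul (fderiv ℝ u x)
    have h1 : fderiv ℝ f x = ContinuousLinearMap.id ℝ E + (1 : ℝ) • fderiv ℝ u x := by
      have : f = fun x => x + u x := by ext y; simp [hu]
      have h2 := ((hasFDerivAt_id x).add (hudiff x)).fderiv
      rw [one_smul, ← h2]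
      congr 1
    have hlt : P.degree < ((Finset.range (n + 1)).card : ℕ) := by
      rw [Finset.card_range]
      calc P.degree ≤ P.natDegree := Polynomial.degree_le_natDegree
        _ < ((n + 1 : ℕ) : WithBot ℕ) := by exact_mod_cast Nat.lt_succ_of_le hPdeg
    rw [h1, ← hP, Lagrange.eq_interpolate hvinj hlt, Lagrange.interpolate_apply,
      Polynomial.eval_finsetSum]
    refine Finset.sum_congr rfl fun j _ => ?_
    rw [Polynomial.eval_mul, Polynomial.eval_C, hP, mul_comm]
  have hInt : ∀ t : ℝ, IntegrableOn
      (fun x => (ContinuousLinearMap.id ℝ E + t • fderiv ℝ u x).det) (ball (0 : E) R) := by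
    intro t
    have hc : Continuous (fun x => (ContinuousLinearMap.id ℝ E + t • fderiv ℝ u x).det) := by
      have := huC.continuous_fderiv one_ne_zero
      exact ContinuousLinearMap.continuous_det.comp (by fun_prop)
    exact (hc.continuousOn.integrableOn_compact (isCompact_closedBall (0 : E) R)).mono_set
      ball_subset_closedBall
  simp_rw [hdet]
  rw [integral_finsetSum _ fun j _ => (hInt (v j)).const_mul _]
  have h3 : ∀ j ∈ Finset.range (n + 1),
      ∫ x in ball (0 : E) R, (Lagrange.basis (Finset.range (n + 1)) v j).eval 1 *
        (ContinuousLinearMap.id ℝ E + v j • fderiv ℝ u x).det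
      = (Lagrange.basis (Finset.range (n + 1)) v j).eval 1 * volume.real (ball (0 : E) R) := by
    intro j hj
    rw [integral_const_mul, hsmall _ (hvs j hj).1 (hvs j hj).2]
  rw [Finset.sum_congr rfl h3, ← Finset.sum_mul, ← Polynomial.eval_finsetSum,
    Lagrange.sum_basis hvinj ⟨0, by simp⟩]
  simp

lemma exists_zero_of_contDiff_eq_id {T : E → E} (hT : ContDiff ℝ 1 T) {R : ℝ}
    (hR : ∀ x, R ≤ ‖x‖ → T x = x) : ∃ x, T x = 0 := by
  by_contra! hne
  obtain ⟨c, hcR, hc0, hc⟩ : ∃ c : ℝ, R ≤ c ∧ 0 < c ∧ ∀ x, ‖x‖ ≤ c → ‖T x‖ ≤ c := by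
    obtain ⟨c, hc⟩ := (isCompact_closedBall (0 : E) R).exists_bound_of_continuousOn
      hT.continuous.continuousOn
    refine ⟨max 1 (max R c), le_trans (le_max_left _ _) (le_max_right _ _),
      lt_of_lt_of_le one_pos (le_max_left _ _), fun x hx => ?_⟩
    by_cases h : ‖x‖ ≤ R
    · exact (hc x (by simpa using h)).trans ((le_max_right _ _).trans (le_max_right _ _))
    · rw [hR x (le_of_not_ge h)]; exact hx
  set m : E → E := fun y => (smoothTransition (‖y‖ - c) +
    (1 - smoothTransition (‖y‖ - c)) * (c / ‖y‖)) • y with hm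
  have hmnorm : ∀ y, y ≠ 0 → ‖m y‖ = c + smoothTransition (‖y‖ - c) * (‖y‖ - c) := by
    intro y hy
    have hy0 : 0 < ‖y‖ := norm_pos_iff.2 hy
    simp only [hm]
    rw [norm_smul, Real.norm_eq_abs, abs_of_nonneg]
    · field_simp; ring
    · have h1 := smoothTransition.nonneg (‖y‖ - c)
      have h2 := smoothTransition.le_one (‖y‖ - c)
      have : 0 ≤ (1 - smoothTransition (‖y‖ - c)) * (c / ‖y‖) :=
        mul_nonneg (by linarith) (by positivity)
      linarith
  set f : E → E := fun x => m (T x) with hf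
  have hfC : ContDiff ℝ 1 f := by
    have hn : ContDiff ℝ 1 fun x => ‖T x‖ := hT.norm ℝ hne
    have hs : ContDiff ℝ 1 fun x => smoothTransition (‖T x‖ - c) :=
      (smoothTransition.contDiff (n := 1)).comp (hn.sub contDiff_const)
    exact (hs.add ((contDiff_const.sub hs).mul
      (contDiff_const.div hn fun x => (norm_pos_iff.2 (hne x)).ne'))).smul hT
  have hfout : ∀ x, c + 1 ≤ ‖x‖ → f x = x := by
    intro x hx
    have h1 : smoothTransition (‖x‖ - c) = 1 := smoothTransition.one_of_one_le (by linarith)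
    simp [hf, hm, hR x (by linarith), h1]
  have hfin : ∀ x ∈ ball (0 : E) c, ‖f x‖ = c := by
    intro x hx
    have hx' : ‖T x‖ ≤ c := hc x (by simpa using (mem_ball_zero_iff.1 hx).le)
    simp only [hf]
    rw [hmnorm _ (hne x), smoothTransition.zero_of_nonpos (by linarith)]
    simp
  have hdet : ∀ x ∈ ball (0 : E) c, (fderiv ℝ f x).det = 0 := by
    intro x hx
    by_contra hd
    have hsurj : Function.Surjective (fderiv ℝ f x) := by
      have := LinearMap.equivOfDetNeZero ((fderiv ℝ f x : E →L[ℝ] E) : E →ₗ[ℝ] E) hd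
      have hu := LinearMap.isUnit_iff_isUnit_det ((fderiv ℝ f x : E →L[ℝ] E) : E →ₗ[ℝ] E)
      have hu' := hu.2 (isUnit_iff_ne_zero.2 hd)
      exact ((Module.End.isUnit_iff _).1 hu').2
    obtain ⟨w, hw⟩ := hsurj (f x)
    have hd1 : HasFDerivAt (fun y => inner ℝ (f y) (f y))
        ((fderivInnerCLM ℝ (f x, f x)).comp ((fderiv ℝ f x).prod (fderiv ℝ f x))) x :=
      ((hfC.differentiable one_ne_zero x).hasFDerivAt).inner ℝ
        ((hfC.differentiable one_ne_zero x).hasFDerivAt)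
    have hd2 : HasFDerivAt (fun y => inner ℝ (f y) (f y)) (0 : E →L[ℝ] ℝ) x := by
      refine (hasFDerivAt_const (c ^ 2) x).congr_of_eventuallyEq ?_
      filter_upwards [isOpen_ball.mem_nhds hx] with y hy
      rw [real_inner_self_eq_norm_sq, hfin y hy]
    have h := DFunLike.congr_fun (hd1.unique hd2) w
    simp [fderivInnerCLM_apply, hw] at h
    have := hfin x hx
    rw [h, norm_zero] at this
    linarith
  have hV := integral_det_fderiv_of_eq_id hfC hfout
  set s : Set E := ball (0 : E) (c + 1) \ ball (0 : E) c with hs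
  have hsm : MeasurableSet s := measurableSet_ball.diff measurableSet_ball
  have hsub : ball (0 : E) c ⊆ ball (0 : E) (c + 1) := ball_subset_ball (by linarith)
  have hcont : Continuous fun x => (fderiv ℝ f x).det :=
    ContinuousLinearMap.continuous_det.comp (hfC.continuous_fderiv one_ne_zero)
  have hInt : IntegrableOn (fun x => (fderiv ℝ f x).det) (ball (0 : E) (c + 1)) :=
    (hcont.continuousOn.integrableOn_compact (isCompact_closedBall (0 : E) (c + 1))).mono_set
      ball_subset_closedBall
  have hfs : ∀ x ∈ s, x ≠ 0 ∧ c ≤ ‖x‖ ∧ f x = m x := by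
    intro x hx
    have h1 : c ≤ ‖x‖ := by simpa using hx.2
    exact ⟨norm_pos_iff.1 (hc0.trans_le h1), h1, by simp only [hf]; rw [hR x (hcR.trans h1)]⟩
  have hinj : InjOn f s := by
    intro x hx y hy hxy
    obtain ⟨hx0, hxc, hfx⟩ := hfs x hx
    obtain ⟨hy0, hyc, hfy⟩ := hfs y hy
    rw [hfx, hfy] at hxy
    have hstrict : ∀ a b : ℝ, c ≤ a → a < b →
        c + smoothTransition (a - c) * (a - c) < c + smoothTransition (b - c) * (b - c) := by
      intro a b ha hab
      have h1 : smoothTransition (a - c) ≤ smoothTransition (b - c) :=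
        smoothTransition.monotone (by linarith)
      have h2 : 0 < smoothTransition (b - c) := smoothTransition.pos_of_pos (by linarith)
      nlinarith
    have hn : ‖x‖ = ‖y‖ := by
      have h := congrArg norm hxy
      rw [hmnorm x hx0, hmnorm y hy0] at h
      rcases lt_trichotomy ‖x‖ ‖y‖ with hlt | heq | hlt
      · exact absurd h (hstrict _ _ hxc hlt).ne
      · exact heq
      · exact absurd h (hstrict _ _ hyc hlt).ne'
    simp only [hm, hn] at hxy
    refine smul_right_injective E ?_ hxy
    intro h0
    have := hmnorm y hy0
    simp only [hm] at this
    rw [h0, zero_smul, norm_zero] at this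
    have h1 := mul_nonneg (smoothTransition.nonneg (‖y‖ - c)) (sub_nonneg.2 hyc)
    linarith
  have himg : f '' s ⊆ s := by
    rintro _ ⟨x, hx, rfl⟩
    obtain ⟨hx0, hxc, hfx⟩ := hfs x hx
    have hx1 : ‖x‖ < c + 1 := by simpa using hx.1
    have h1 := smoothTransition.nonneg (‖x‖ - c)
    have h2 := smoothTransition.le_one (‖x‖ - c)
    simp only [hs, Set.mem_sdiff, mem_ball, dist_zero_right, not_lt]
    rw [hfx, hmnorm x hx0]
    constructor <;> nlinarith
  have hb : ∫ x in ball (0 : E) c, (fderiv ℝ f x).det = 0 := by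
    rw [setIntegral_congr_fun measurableSet_ball hdet]
    simp
  have hsplit := setIntegral_union (μ := volume) (f := fun x => (fderiv ℝ f x).det)
    (disjoint_sdiff_self_right : Disjoint (ball (0 : E) c) s) hsm
    (hInt.mono_set hsub) (hInt.mono_set sdiff_subset)
  rw [union_sdiff_cancel hsub, hV, hb, zero_add] at hsplit
  have hle : ∫ x in s, (fderiv ℝ f x).det ≤ volume.real (f '' s) := by
    have key := integral_image_eq_integral_abs_det_fderiv_smul (volume : Measure E)
      (f := f) (f' := fderiv ℝ f) hsm
      (fun x _ => (hfC.differentiable one_ne_zero x).hasFDerivAt.hasFDerivWithinAt)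
      hinj (fun _ => (1 : ℝ))
    simp only [smul_eq_mul, mul_one, integral_const, MeasurableSet.univ, measureReal_restrict_apply,
      univ_inter] at key
    rw [key]
    have hi := hInt.mono_set (sdiff_subset : s ⊆ _)
    exact setIntegral_mono hi hi.abs fun x => le_abs_self _
  have hfin1 : volume (ball (0 : E) (c + 1)) ≠ ⊤ := measure_ball_lt_top.ne
  have hle2 : volume.real (f '' s) ≤ volume.real s :=
    measureReal_mono himg (ne_top_of_le_ne_top hfin1 (measure_mono sdiff_subset))
  have hs3 : volume.real s = volume.real (ball (0 : E) (c + 1)) - volume.real (ball (0 : E) c) :=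
    measureReal_sdiff hsub measurableSet_ball
  have hpos : 0 < volume.real (ball (0 : E) c) :=
    ENNReal.toReal_pos (measure_ball_pos volume 0 hc0).ne' measure_ball_lt_top.ne
  linarith

end Measure

/-- A form of Brouwer's theorem. -/
theorem exists_zero_of_norm_sub_le {T : E → E} (hT : Continuous T) {D : ℝ}
    (hD : ∀ x, ‖T x - x‖ ≤ D) : ∃ x, ‖x‖ ≤ D ∧ T x = 0 := by
  borelize E
  set χ : E → ℝ := fun x => max 0 (min 1 (D + 1 - ‖x‖)) with hχ
  have hχ0 : ∀ x, 0 ≤ χ x := fun x => le_max_left _ _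
  have hχ1 : ∀ x, χ x ≤ 1 := fun x => max_le zero_le_one (min_le_left _ _)
  set U : E → E := fun x => χ x • (T x - x) with hU
  have hUc : Continuous U := by
    simp only [hU, hχ]; fun_prop
  have hzero : ∃ x, x + U x = 0 := by
    by_contra! hne
    obtain ⟨r, hr0, hr⟩ : ∃ r > 0, ∀ x, r ≤ ‖x + U x‖ := by
      obtain hem | hnem := (closedBall (0 : E) (D + 1)).eq_empty_or_nonempty
      · have hDn : 0 ≤ D := (norm_nonneg _).trans (hD 0)
        exact absurd (mem_closedBall_self (x := (0 : E)) (by linarith : 0 ≤ D + 1)) (by simp [hem])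
      obtain ⟨x0, -, hx0⟩ := (isCompact_closedBall (0 : E) (D + 1)).exists_isMinOn hnem
        (f := fun x => ‖x + U x‖) (by fun_prop)
      have hDn : 0 ≤ D := (norm_nonneg _).trans (hD 0)
      refine ⟨min ‖x0 + U x0‖ 1, lt_min (norm_pos_iff.2 (hne x0)) one_pos, fun x => ?_⟩
      by_cases h : ‖x‖ ≤ D + 1
      · exact (min_le_left _ _).trans (hx0 (by simpa using h))
      · push Not at h
        have : χ x = 0 := by
          simp only [hχ]
          exact max_eq_left ((min_le_right _ _).trans (by linarith))
        simp only [hU, this, zero_smul, add_zero]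
        exact (min_le_right _ _).trans (by linarith)
    obtain ⟨g, hgC, hg, hgs⟩ := hUc.exists_contDiff_approx 1 (ε := fun _ => r)
      continuous_const (fun _ => hr0)
    obtain ⟨x, hx⟩ := exists_zero_of_contDiff_eq_id (T := fun x => x + g x) (R := D + 1)
      (contDiff_id.add (by exact_mod_cast hgC)) (by
        intro x hx
        have : g x = 0 := by
          by_contra h
          have h2 : U x ≠ 0 := hgs h
          apply h2
          have : χ x = 0 := by
            simp only [hχ]
            exact max_eq_left ((min_le_right _ _).trans (by linarith))
          simp [hU, this]
        simp [this])
    have h1 := hr x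
    have h2 := hg x
    have h3 : x + U x = U x - g x := by
      calc x + U x = (x + g x) + (U x - g x) := by abel
        _ = U x - g x := by rw [hx, zero_add]
    rw [h3, ← dist_eq_norm, dist_comm] at h1
    linarith
  obtain ⟨x, hx⟩ := hzero
  have hxn : ‖x‖ ≤ D := by
    rw [eq_neg_of_add_eq_zero_left hx, norm_neg]
    simp only [hU]
    rw [norm_smul, Real.norm_eq_abs, abs_of_nonneg (hχ0 x)]
    calc χ x * ‖T x - x‖ ≤ 1 * ‖T x - x‖ := by gcongr; exact hχ1 x
      _ ≤ D := by rw [one_mul]; exact hD x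
  have h1 : χ x = 1 := by
    simp only [hχ]
    rw [min_eq_left (by linarith), max_eq_right zero_le_one]
  refine ⟨x, hxn, ?_⟩
  simpa [hU, h1] using hx

end Brouwer

section Minimax

variable {W V : Type*} [NormedAddCommGroup W] [InnerProductSpace ℝ W] [FiniteDimensional ℝ W]
  [NormedAddCommGroup V] [InnerProductSpace ℝ V] [FiniteDimensional ℝ V]

lemma sub_inner_le_of_gradient_near {S : W → ℝ} {g : W → W} (hS : ∀ x, HasGradientAt S (g x) x)
    {x : W} {c r : ℝ} (h : ∀ y, ‖y - x‖ ≤ r → ‖g y - g x‖ ≤ c) {y : W} (hy : ‖y - x‖ ≤ r) :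
    |S y - S x - inner ℝ (g x) (y - x)| ≤ c * ‖y - x‖ := by
  have hr : 0 ≤ r := (norm_nonneg _).trans hy
  have := (convex_closedBall x r).norm_image_sub_le_of_norm_hasFDerivWithin_le
    (f := fun y => S y - inner ℝ (g x) y)
    (f' := fun y => InnerProductSpace.toDual ℝ W (g y) - InnerProductSpace.toDual ℝ W (g x))
    (C := c) (x := x) (y := y) ?_ ?_ (mem_closedBall_self hr)
    (by simpa [dist_eq_norm] using hy)
  · have e : S y - inner ℝ (g x) y - (S x - inner ℝ (g x) x) =
        S y - S x - inner ℝ (g x) (y - x) := by rw [inner_sub_right]; ring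
    rw [e] at this
    exact this
  · intro z hz
    exact ((hS z).hasFDerivAt.sub
      (InnerProductSpace.toDual ℝ W (g x)).hasFDerivAt).hasFDerivWithinAt
  · intro z hz
    rw [← map_sub, LinearIsometryEquiv.norm_map]
    exact h z (by simpa [dist_eq_norm] using hz)

/-- A linking argument: a `C¹` function bounded below on a complement and above on a section
cannot have gradient bounded away from zero at high levels. -/
theorem false_of_linking (P : W →L[ℝ] V) (s : V →L[ℝ] W) (hPs : ∀ y, P (s y) = y)
    {S : W → ℝ} {g : W → W} (hS : ∀ x, HasGradientAt S (g x) x) (hg : Continuous g)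
    {ε B c₀ : ℝ} (hε : 0 < ε) (hker : ∀ x, P x = 0 → ε ≤ S x) (hsec : ∀ y, S (s y) ≤ B)
    (hc₀ : 0 < c₀) (hgrad : ∀ x, ε / 2 ≤ S x → c₀ ≤ ‖g x‖) : False := by
  set c : ℝ := c₀ ^ 2 / (2 * (1 + c₀)) with hc
  have hcpos : 0 < c := by positivity
  set v : W → W := fun x => (1 + ‖g x‖)⁻¹ • g x with hv
  have hvn : ∀ x, ‖v x‖ ≤ 1 := by
    intro x
    simp only [hv]
    rw [norm_smul, norm_inv, Real.norm_eq_abs, abs_of_pos (by positivity),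
      inv_mul_le_iff₀ (by positivity)]
    linarith [norm_nonneg (g x)]
  have hvc : Continuous v := by
    simp only [hv]
    exact (Continuous.inv₀ (by fun_prop) fun x => by positivity).smul hg
  have hgv0 : ∀ x, 0 ≤ inner ℝ (g x) (v x) := by
    intro x
    simp only [hv]
    rw [inner_smul_right, real_inner_self_eq_norm_sq]
    positivity
  have hgv : ∀ x, ε / 2 ≤ S x → 2 * c ≤ inner ℝ (g x) (v x) := by
    intro x hx
    have h := hgrad x hx
    simp only [hv]
    rw [inner_smul_right, real_inner_self_eq_norm_sq, hc, inv_mul_eq_div]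
    rw [show 2 * (c₀ ^ 2 / (2 * (1 + c₀))) = c₀ ^ 2 / (1 + c₀) by field_simp]
    rw [div_le_div_iff₀ (by positivity) (by positivity)]
    nlinarith [mul_nonneg hc₀.le (norm_nonneg (g x)), mul_nonneg (mul_nonneg hc₀.le
      (norm_nonneg (g x))) (sub_nonneg.2 h), sq_nonneg (‖g x‖ - c₀)]
  set T : ℝ := |B| / c with hT
  have hT0 : 0 ≤ T := by positivity
  set D : ℝ := ‖P‖ * (T + 1) with hD
  set ρ : ℝ := ‖s‖ * D + (T + 1) with hρ
  have huc := (isCompact_closedBall (0 : W) (ρ + 1)).uniformContinuousOn_of_continuous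
    hg.continuousOn
  rw [Metric.uniformContinuousOn_iff] at huc
  obtain ⟨δ, hδ, huc⟩ := huc c hcpos
  set τ : ℝ := min 1 (min (δ / 2) (ε / (4 * c))) with hτ
  have hτ0 : 0 < τ := by simp only [hτ]; positivity
  have hτ1 : τ ≤ 1 := min_le_left _ _
  have hτδ : τ < δ := ((min_le_right _ _).trans (min_le_left _ _)).trans_lt (by linarith)
  have hτε : τ * c ≤ ε / 4 := by
    have : τ ≤ ε / (4 * c) := (min_le_right _ _).trans (min_le_right _ _)
    calc τ * c ≤ ε / (4 * c) * c := by gcongr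
      _ = ε / 4 := by field_simp
  set f : W → W := fun x => x - τ • v x with hf
  have hfc : Continuous f := by fun_prop
  have hfn : ∀ x, ‖f x - x‖ ≤ τ := by
    intro x
    simp only [hf]
    rw [sub_sub_cancel_left, norm_neg, norm_smul, Real.norm_eq_abs, abs_of_pos hτ0]
    nlinarith [hvn x]
  have hdec : ∀ x, ‖x‖ ≤ ρ → S (f x) ≤ S x - τ * inner ℝ (g x) (v x) + τ * c := by
    intro x hx
    have h := sub_inner_le_of_gradient_near hS (x := x) (c := c) (r := τ) (fun y hy => by
      have h1 : ‖y‖ ≤ ρ + 1 := by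
        calc ‖y‖ = ‖(y - x) + x‖ := by rw [sub_add_cancel]
          _ ≤ ‖y - x‖ + ‖x‖ := norm_add_le _ _
          _ ≤ ρ + 1 := by linarith
      have := huc y (by simpa using h1) x (by simpa using hx.trans (by linarith))
        (by rw [dist_eq_norm]; linarith)
      rw [dist_eq_norm] at this
      exact this.le) (hfn x)
    have h2 := (le_abs_self _).trans h
    have h3 : f x - x = - (τ • v x) := by simp [hf]
    have h4 : c * ‖f x - x‖ ≤ c * τ := by gcongr; exact hfn x
    rw [h3, inner_neg_right, inner_smul_right] at h2
    rw [h3] at h4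
    linarith
  have hitn : ∀ (k : ℕ) x, ‖f^[k] x - x‖ ≤ k * τ := by
    intro k
    induction k with
    | zero => intro x; simp
    | succ k ih =>
      intro x
      rw [Function.iterate_succ_apply']
      calc ‖f (f^[k] x) - x‖ = ‖(f (f^[k] x) - f^[k] x) + (f^[k] x - x)‖ := by
            rw [sub_add_sub_cancel]
        _ ≤ τ + k * τ := (norm_add_le _ _).trans (add_le_add (hfn _) (ih x))
        _ = _ := by push_cast; ring
  set n : ℕ := ⌈T / τ⌉₊ with hn
  have hnT : T ≤ n * τ := by
    rw [← div_le_iff₀ hτ0]; exact Nat.le_ceil _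
  have hnT1 : n * τ ≤ T + 1 := by
    have := Nat.ceil_lt_add_one (div_nonneg hT0 hτ0.le)
    have h2 : (n : ℝ) * τ ≤ (T / τ + 1) * τ := by gcongr
    rw [add_mul, div_mul_cancel₀ _ hτ0.ne'] at h2
    linarith
  obtain ⟨y, hyD, hy⟩ := exists_zero_of_norm_sub_le (T := fun y => P (f^[n] (s y))) (D := D)
    (P.continuous.comp ((hfc.iterate n).comp s.continuous)) (by
      intro y
      have : P (f^[n] (s y)) - y = P (f^[n] (s y) - s y) := by rw [map_sub, hPs]
      simp only [this]
      refine (P.le_opNorm _).trans ?_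
      exact mul_le_mul_of_nonneg_left ((hitn n _).trans hnT1) (norm_nonneg _))
  have hbound : ∀ k ≤ n, ‖f^[k] (s y)‖ ≤ ρ := by
    intro k hk
    calc ‖f^[k] (s y)‖ = ‖s y + (f^[k] (s y) - s y)‖ := by rw [add_sub_cancel]
      _ ≤ ‖s y‖ + ‖f^[k] (s y) - s y‖ := norm_add_le _ _
      _ ≤ ‖s‖ * D + (T + 1) := by
        refine add_le_add ((s.le_opNorm _).trans ?_) ((hitn k _).trans (le_trans ?_ hnT1))
        · gcongr
        · gcongr
  have hval : ∀ k ≤ n, S (f^[k] (s y)) ≤ max (B - k * τ * c) (3 * ε / 4) := by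
    intro k
    induction k with
    | zero => intro _; simp [hsec y]
    | succ k ih =>
      intro hk
      have h1 := ih (by omega)
      have h2 := hdec _ (hbound k (by omega))
      rw [Function.iterate_succ_apply']
      by_cases hx : ε / 2 ≤ S (f^[k] (s y))
      · have h3 := hgv _ hx
        have h4 : S (f (f^[k] (s y))) ≤ S (f^[k] (s y)) - τ * c := by nlinarith
        rcases le_max_iff.1 h1 with h5 | h5
        · refine le_max_of_le_left ?_
          push_cast
          linarith
        · exact le_max_of_le_right (by nlinarith)
      · push Not at hx
        refine le_max_of_le_right ?_
        have := mul_nonneg hτ0.le (hgv0 (f^[k] (s y)))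
        linarith
  have h1 := hker _ hy
  have h2 := hval n le_rfl
  have h3 : B - n * τ * c ≤ 0 := by
    have : T * c ≤ n * τ * c := by gcongr
    rw [hT, div_mul_cancel₀ _ hcpos.ne'] at this
    linarith [le_abs_self B]
  rcases le_max_iff.1 h2 with h | h <;> linarith

end Minimax

section Whitney

variable {E : Type*} [NormedAddCommGroup E] [InnerProductSpace ℝ E]

lemma hasGradientAt_of_quadratic [CompleteSpace E] {Φ : E → ℝ} {v x : E} {C : ℝ}
    (h : ∀ y, |Φ y - Φ x - inner ℝ v (y - x)| ≤ C * ‖y - x‖ ^ 2) : HasGradientAt Φ v x := by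
  rw [hasGradientAt_iff_isLittleO]
  have h1 : (fun y => Φ y - Φ x - inner ℝ v (y - x)) =O[𝓝 x] fun y => ‖y - x‖ ^ 2 :=
    Asymptotics.IsBigO.of_bound C (Eventually.of_forall fun y => by
      simpa using h y)
  refine h1.trans_isLittleO ?_
  have : (fun y => ‖y - x‖ ^ 2) =o[𝓝 x] fun y => ‖y - x‖ := by
    have h2 := (Asymptotics.isLittleO_pow_id (𝕜 := ℝ) (n := 2) (by norm_num))
    refine h2.comp_tendsto (k := fun y => ‖y - x‖) ?_
    have : Continuous fun y => ‖y - x‖ := by fun_prop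
    simpa using this.tendsto x
  exact this.norm_right.trans_isBigO (Asymptotics.isBigO_norm_left.2 (by
    simpa using Asymptotics.isBigO_refl (fun y => y - x) (𝓝 x)))

lemma eq_zero_of_inner_le_sq {d : E} {C : ℝ} (hC : 0 ≤ C)
    (h : ∀ u, inner ℝ d u ≤ C * ‖u‖ ^ 2) : d = 0 := by
  have h1 := h ((2 * C + 1)⁻¹ • d)
  rw [inner_smul_right, real_inner_self_eq_norm_sq, norm_smul, norm_inv, Real.norm_eq_abs,
    abs_of_pos (by positivity), mul_pow, inv_pow] at h1
  have h2 : (2 * C + 1) * ‖d‖ ^ 2 ≤ C * ‖d‖ ^ 2 := by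
    have := mul_le_mul_of_nonneg_left h1 (by positivity : 0 ≤ (2 * C + 1) ^ 2)
    field_simp at this
    linarith
  have h3 : ‖d‖ ^ 2 ≤ 0 := by nlinarith [sq_nonneg ‖d‖]
  have : ‖d‖ = 0 := by nlinarith [sq_nonneg ‖d‖]
  exact norm_eq_zero.1 this

lemma norm_sub_le_of_quadratic {Φ : E → ℝ} {v : E → E} {C : ℝ}
    (h : ∀ x y, |Φ y - Φ x - inner ℝ (v x) (y - x)| ≤ C * ‖y - x‖ ^ 2) (x y : E) :
    ‖v y - v x‖ ≤ 6 * C * ‖y - x‖ := by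
  by_cases hd : v y - v x = 0
  · rw [hd, norm_zero]
    by_cases hxy : y - x = 0
    · simp [hxy]
    · have h1 := (abs_nonneg _).trans (h x y)
      have h2 : 0 < ‖y - x‖ := norm_pos_iff.2 hxy
      have h3 : 0 ≤ C := by
        by_contra hC
        push Not at hC
        nlinarith [pow_pos h2 2]
      positivity
  have hd0 : 0 < ‖v y - v x‖ := norm_pos_iff.2 hd
  set d := v y - v x with hdd
  set r := ‖y - x‖ with hr
  have hr0 : 0 ≤ r := norm_nonneg _
  set u : E := (r / ‖d‖) • d with hu
  have hun : ‖u‖ = r := by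
    rw [hu, norm_smul, Real.norm_eq_abs, abs_of_nonneg (by positivity)]
    field_simp
  have hdu : inner ℝ d u = r * ‖d‖ := by
    rw [hu, inner_smul_right, real_inner_self_eq_norm_sq]
    field_simp
  have h1 := abs_le.1 (h x (y + u))
  have h2 := abs_le.1 (h y (y + u))
  have h3 := abs_le.1 (h x y)
  rw [add_sub_cancel_left, hun] at h2
  have e1 : y + u - x = (y - x) + u := by abel
  rw [e1, inner_add_right] at h1
  have hn : ‖y - x + u‖ ≤ 2 * r := (norm_add_le _ _).trans (by rw [hun]; linarith)
  have hC : 0 ≤ C ∨ r = 0 := by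
    by_cases hr' : r = 0
    · exact Or.inr hr'
    · left
      have h4 := (abs_nonneg _).trans (h x y)
      have h5 : 0 < r := lt_of_le_of_ne hr0 (Ne.symm hr')
      by_contra hC
      push Not at hC
      nlinarith [pow_pos h5 2]
  rcases hC with hC | hr'
  · have h4 : C * ‖y - x + u‖ ^ 2 ≤ C * (2 * r) ^ 2 := by gcongr
    have h5 : inner ℝ d u = inner ℝ (v y) u - inner ℝ (v x) u := by rw [hdd, inner_sub_left]
    have h6 : r * ‖d‖ ≤ r * (6 * C * r) := by
      rw [← hdu, h5]; nlinarith
    by_cases hr' : r = 0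
    · have : y = x := sub_eq_zero.1 (norm_eq_zero.1 hr')
      exact absurd (by rw [hdd, this, sub_self]) hd
    · exact le_of_mul_le_mul_left h6 (lt_of_le_of_ne hr0 (Ne.symm hr'))
  · have : y = x := sub_eq_zero.1 (norm_eq_zero.1 hr')
    exact absurd (by rw [hdd, this, sub_self]) hd

lemma whitney_comparison {fi fj M : ℝ} {ai aj Di Dj : E} (hM : 0 ≤ M)
    (h1 : |fj - fi - inner ℝ Di (aj - ai)| ≤ M * ‖aj - ai‖ ^ 2)
    (h2 : ‖Di - Dj‖ ≤ M * ‖aj - ai‖) (w : E) :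
    fi + inner ℝ Di (w - ai) - 4 * M * ‖w - ai‖ ^ 2 ≤
      fj + inner ℝ Dj (w - aj) + 4 * M * ‖w - aj‖ ^ 2 := by
  set e := aj - ai with he
  have h3 : w - ai = (w - aj) + e := by rw [he]; abel
  have h4 := (abs_le.1 h1).1
  have h5 : inner ℝ (Di - Dj) (w - aj) ≤ M * ‖e‖ * ‖w - aj‖ :=
    (real_inner_le_norm _ _).trans (by gcongr)
  have h6 : inner ℝ Di (w - ai) = inner ℝ Di (w - aj) + inner ℝ Di e := by
    rw [h3, inner_add_right]
  rw [inner_sub_left] at h5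
  have h7 : ‖e‖ ≤ ‖w - ai‖ + ‖w - aj‖ := by
    have : e = (w - ai) - (w - aj) := by rw [he]; abel
    rw [this]; exact norm_sub_le _ _
  have ha := norm_nonneg (w - ai)
  have hb := norm_nonneg (w - aj)
  have h8 : ‖e‖ ^ 2 + ‖e‖ * ‖w - aj‖ ≤ 4 * (‖w - ai‖ ^ 2 + ‖w - aj‖ ^ 2) := by
    nlinarith [norm_nonneg e, sq_nonneg (‖w - ai‖ - ‖w - aj‖)]
  have h9 := mul_le_mul_of_nonneg_left h8 hM
  nlinarith

variable [FiniteDimensional ℝ E]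

lemma ConvexOn.exists_subgradient {F : E → ℝ} (hF : ConvexOn ℝ univ F) (x : E) :
    ∃ v : E, ∀ y, F x + inner ℝ v (y - x) ≤ F y := by
  have hc : Continuous F := by
    rw [← continuousOn_univ]; exact hF.continuousOn isOpen_univ
  have hopen : IsOpen {p : E × ℝ | p.1 ∈ (univ : Set E) ∧ F p.1 < p.2} := by
    simp only [mem_univ, true_and]
    exact isOpen_lt (hc.comp continuous_fst) continuous_snd
  obtain ⟨φ, hφ⟩ := geometric_hahn_banach_open_point (x := (x, F x))
    hF.convex_strict_epigraph hopen (by simp)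
  set l : E →L[ℝ] ℝ := φ.comp (ContinuousLinearMap.inl ℝ E ℝ) with hl
  set b : ℝ := φ (0, 1) with hb
  have hsplit : ∀ y r, φ (y, r) = l y + r * b := by
    intro y r
    have : ((y, r) : E × ℝ) = (y, 0) + r • (0, 1) := by simp
    rw [this, map_add, map_smul]
    simp [hl, hb]
  have hb0 : b < 0 := by
    have := hφ (x, F x + 1) (by simp)
    rw [hsplit, hsplit] at this
    linarith
  refine ⟨(InnerProductSpace.toDual ℝ E).symm ((-b)⁻¹ • l), fun y => ?_⟩
  rw [InnerProductSpace.toDual_symm_apply]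
  refine le_of_forall_gt_imp_ge_of_dense fun r hr => ?_
  have := hφ (y, r) (by simpa using hr)
  rw [hsplit, hsplit] at this
  have h2 : l (y - x) ≤ (-b) * (r - F x) := by rw [map_sub]; linarith
  have h3 : (-b)⁻¹ * l (y - x) ≤ r - F x := by
    rw [inv_mul_le_iff₀ (by linarith)]; exact h2
  simp only [FunLike.coe_smul, Pi.smul_apply, smul_eq_mul]
  linarith

/-- Whitney's extension theorem for `C^{1,1}` jets, in a form natural in the data. -/
theorem exists_whitney_extension {ι : Type*} [Nonempty ι] (a : ι → E) (f : ι → ℝ) (D : ι → E)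
    {M : ℝ} (hM : 0 ≤ M)
    (h1 : ∀ i j, |f j - f i - inner ℝ (D i) (a j - a i)| ≤ M * ‖a j - a i‖ ^ 2)
    (h2 : ∀ i j, ‖D i - D j‖ ≤ M * ‖a j - a i‖) :
    ∃ (Φ : E → ℝ) (v : E → E),
      (∀ x y, |Φ y - Φ x - inner ℝ (v x) (y - x)| ≤ 16 * M * ‖y - x‖ ^ 2) ∧
      (∀ i, Φ (a i) = f i) ∧ (∀ i, v (a i) = D i) ∧
      ∀ e : E, (∀ i, ∃ j, a j = a i + e ∧ f j = f i ∧ D j = D i) → ∀ w, Φ (w + e) ≤ Φ w := by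
  set A : ℝ := 4 * M with hA
  have hA0 : 0 ≤ A := by positivity
  set P : ι → E → ℝ := fun j w => f j + inner ℝ (D j) (w - a j) + A * ‖w - a j‖ ^ 2 +
    A * ‖w‖ ^ 2 with hP
  set k : ι → E → ℝ := fun i w => f i + inner ℝ (D i) (w - a i) - A * ‖w - a i‖ ^ 2 +
    A * ‖w‖ ^ 2 with hk
  have hkP : ∀ i j w, k i w ≤ P j w := by
    intro i j w
    have := whitney_comparison hM (h1 i j) (h2 i j) w
    simp only [hk, hP]; linarith
  have haff : ∀ i w u, k i (w + u) = k i w + inner ℝ (D i + (2 * A) • a i) u := by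
    intro i w u
    simp only [hk]
    have e1 : w + u - a i = (w - a i) + u := by abel
    rw [e1, norm_add_sq_real, norm_add_sq_real, inner_add_right, inner_add_left, inner_smul_left,
      inner_sub_left]
    simp
    ring
  have hkconv : ∀ i, ConvexOn ℝ univ (k i) := by
    intro i
    have e : k i = fun w => innerₛₗ ℝ (D i + (2 * A) • a i) w + k i 0 := by
      ext w
      have := haff i 0 w
      rw [zero_add] at this
      rw [this, add_comm]
      rfl
    rw [e]
    exact ((innerₛₗ ℝ (D i + (2 * A) • a i)).convexOn convex_univ).add_const _
  set K : Set (E → ℝ) := {g | ConvexOn ℝ univ g ∧ ∀ j w, g w ≤ P j w} with hK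
  have hkK : ∀ i, k i ∈ K := fun i => ⟨hkconv i, hkP i⟩
  set F : E → ℝ := fun w => sSup ((fun g : E → ℝ => g w) '' K) with hF
  have i0 : ι := Classical.arbitrary ι
  have hbdd : ∀ w, BddAbove ((fun g : E → ℝ => g w) '' K) := by
    rintro w
    refine ⟨P i0 w, ?_⟩
    rintro _ ⟨g, hg, rfl⟩
    exact hg.2 i0 w
  have hne : ∀ w, ((fun g : E → ℝ => g w) '' K).Nonempty := fun w => ⟨_, k i0, hkK i0, rfl⟩
  have hleF : ∀ g ∈ K, ∀ w, g w ≤ F w := fun g hg w => le_csSup (hbdd w) ⟨g, hg, rfl⟩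
  have hFle : ∀ w c, (∀ g ∈ K, g w ≤ c) → F w ≤ c := by
    intro w c h
    refine csSup_le (hne w) ?_
    rintro _ ⟨g, hg, rfl⟩
    exact h g hg
  have hFP : ∀ j w, F w ≤ P j w := fun j w => hFle w _ fun g hg => hg.2 j w
  have hFconv : ConvexOn ℝ univ F := by
    refine ⟨convex_univ, fun x _ y _ s t hs ht hst => hFle _ _ fun g hg => ?_⟩
    refine (hg.1.2 (mem_univ x) (mem_univ y) hs ht hst).trans ?_
    simp only [smul_eq_mul]
    gcongr
    · exact hleF g hg x
    · exact hleF g hg y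
  have hshift : ∀ x h, F (x + h) + F (x - h) - 2 * F x ≤ 4 * A * ‖h‖ ^ 2 := by
    intro x h
    have hmem : (fun y => (1 / 2) * F (y + h) + (1 / 2) * F (y + -h) + -(2 * A * ‖h‖ ^ 2)) ∈ K := by
      refine ⟨?_, fun j w => ?_⟩
      · have c1 : ∀ u : E, ConvexOn ℝ univ fun y => (1 / 2 : ℝ) * F (y + u) := by
          intro u
          have := (hFconv.translate_left u).smul (by norm_num : (0 : ℝ) ≤ 1 / 2)
          simpa [Function.comp_def] using this
        exact ((c1 h).add (c1 (-h))).add_const _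
      · have p1 := hFP j (w + h)
        have p2 := hFP j (w + -h)
        simp only [hP] at p1 p2 ⊢
        have e1 : w + h - a j = (w - a j) + h := by abel
        have e2 : w + -h - a j = (w - a j) - h := by abel
        have e3 : w + -h = w - h := by abel
        rw [e1, norm_add_sq_real, norm_add_sq_real, inner_add_right] at p1
        rw [e2, e3, norm_sub_sq_real (w - a j) h, norm_sub_sq_real w h, inner_sub_right] at p2
        rw [e3]
        linarith
    have := hleF _ hmem x
    simp only [← sub_eq_add_neg] at this
    linarith
  choose s hs using fun x => hFconv.exists_subgradient x
  have hs2 : ∀ x y, F y ≤ F x + inner ℝ (s x) (y - x) + 4 * A * ‖y - x‖ ^ 2 := by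
    intro x y
    have p1 := hshift x (y - x)
    have p2 := hs x (x - (y - x))
    have e1 : x + (y - x) = y := by abel
    have e2 : x - (y - x) - x = -(y - x) := by abel
    rw [e1] at p1
    rw [e2, inner_neg_right] at p2
    linarith
  have hFa : ∀ i, F (a i) = f i + A * ‖a i‖ ^ 2 := by
    intro i
    apply le_antisymm
    · simpa [hP] using hFP i (a i)
    · simpa [hk] using hleF _ (hkK i) (a i)
  refine ⟨fun w => F w - A * ‖w‖ ^ 2, fun w => s w - (2 * A) • w, ?_, ?_, ?_, ?_⟩
  · intro x y
    have p1 := hs x y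
    have p2 := hs2 x y
    have e : ‖y‖ ^ 2 = ‖x‖ ^ 2 + 2 * inner ℝ x (y - x) + ‖y - x‖ ^ 2 := by
      rw [← norm_add_sq_real, add_sub_cancel]
    simp only
    rw [e, inner_sub_left, inner_smul_left, abs_le]
    simp only [conj_trivial]
    have := mul_nonneg hA0 (sq_nonneg ‖y - x‖)
    constructor <;> nlinarith
  · intro i
    simp only
    rw [hFa]; ring
  · intro i
    have : D i + (2 * A) • a i - s (a i) = 0 := by
      refine eq_zero_of_inner_le_sq (C := 4 * A) (by positivity) fun u => ?_
      have p1 := hleF _ (hkK i) (a i + u)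
      have p2 := hs2 (a i) (a i + u)
      rw [haff] at p1
      have p3 : k i (a i) = F (a i) := by rw [hFa]; simp [hk]
      rw [add_sub_cancel_left] at p2
      rw [inner_sub_left]
      linarith
    simp only
    rw [sub_eq_iff_eq_add]
    exact (sub_eq_zero.1 this).symm
  · intro e he w
    have hmem : (fun y => F (y + e) + (innerₛₗ ℝ (-((2 * A) • e)) y + -(A * ‖e‖ ^ 2))) ∈ K := by
      refine ⟨?_, fun i y => ?_⟩
      · refine ConvexOn.add ?_
          (((innerₛₗ ℝ (-((2 * A) • e))).convexOn convex_univ).add_const _)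
        simpa [Function.comp_def] using hFconv.translate_left e
      · obtain ⟨j, hj1, hj2, hj3⟩ := he i
        have p := hFP j (y + e)
        simp only [hP, hj1, hj2, hj3] at p ⊢
        rw [add_sub_add_right_eq_sub, norm_add_sq_real] at p
        simp only [innerₛₗ_apply_apply, inner_neg_left, inner_smul_left, conj_trivial]
        rw [real_inner_comm]
        linarith
    have := hleF _ hmem w
    simp only [innerₛₗ_apply_apply, inner_neg_left, inner_smul_left, conj_trivial] at this
    rw [real_inner_comm] at this
    simp only
    rw [norm_add_sq_real]
    linarith

end Whitney

section Chain

/-- The configuration space of a chain with `N` links: coordinates `q₀, …, q_N` and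
`η₀, …, η_{N-1}`. -/
abbrev ChainSpace (N : ℕ) := EuclideanSpace ℝ (Fin (N + 1) ⊕ Fin N)

/-- The coordinate `q_i` (zero when out of range). -/
def chainQ (N i : ℕ) : ChainSpace N →L[ℝ] ℝ :=
  if h : i < N + 1 then EuclideanSpace.proj (Sum.inl ⟨i, h⟩) else 0

/-- The coordinate `η_i` (zero when out of range). -/
def chainEta (N i : ℕ) : ChainSpace N →L[ℝ] ℝ :=
  if h : i < N then EuclideanSpace.proj (Sum.inr ⟨i, h⟩) else 0

/-- The derivative at a point with partial derivatives `a`, `b`, `c`. -/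
def partialsCLM (a b c : ℝ) : ℝ × ℝ × ℝ →L[ℝ] ℝ :=
  a • ContinuousLinearMap.fst ℝ ℝ (ℝ × ℝ) +
    b • (ContinuousLinearMap.fst ℝ ℝ ℝ).comp (ContinuousLinearMap.snd ℝ ℝ (ℝ × ℝ)) +
    c • (ContinuousLinearMap.snd ℝ ℝ ℝ).comp (ContinuousLinearMap.snd ℝ ℝ (ℝ × ℝ))

variable {N : ℕ} (G GQ Gη GZ : ℕ → ℝ × ℝ × ℝ → ℝ)

/-- The partial actions of the chain. -/
def chainV (N : ℕ) (G : ℕ → ℝ × ℝ × ℝ → ℝ) : ℕ → ChainSpace N → ℝ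
  | 0, _ => 0
  | i + 1, w => chainV N G i w + chainEta N i w * (chainQ N (i + 1) w - chainQ N i w) +
      G i (chainQ N (i + 1) w, chainEta N i w, chainV N G i w)

/-- The argument of the `i`-th generating function. -/
def chainX (N : ℕ) (G : ℕ → ℝ × ℝ × ℝ → ℝ) (i : ℕ) (w : ChainSpace N) : ℝ × ℝ × ℝ :=
  (chainQ N (i + 1) w, chainEta N i w, chainV N G i w)

/-- The momentum at the end of the `i`-th link. -/
def chainP (N : ℕ) (G GQ : ℕ → ℝ × ℝ × ℝ → ℝ) : ℕ → ChainSpace N → ℝ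
  | 0, _ => 0
  | i + 1, w => chainEta N i w + GQ i (chainX N G i w)

/-- The derivative of `chainV`. -/
def chainDV (N : ℕ) : ℕ → ChainSpace N → (ChainSpace N →L[ℝ] ℝ)
  | 0, _ => 0
  | i + 1, w => chainDV N i w + (chainEta N i w • (chainQ N (i + 1) - chainQ N i) +
      (chainQ N (i + 1) w - chainQ N i w) • chainEta N i) +
      (partialsCLM (GQ i (chainX N G i w)) (Gη i (chainX N G i w)) (GZ i (chainX N G i w))).comp
        ((chainQ N (i + 1)).prod ((chainEta N i).prod (chainDV N i w)))

lemma chainV_succ (i : ℕ) (w : ChainSpace N) : chainV N G (i + 1) w =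
    chainV N G i w + chainEta N i w * (chainQ N (i + 1) w - chainQ N i w) +
      G i (chainX N G i w) := rfl

lemma chainDV_succ_apply (i : ℕ) (w e : ChainSpace N) :
    chainDV G GQ Gη GZ N (i + 1) w e =
      (1 + GZ i (chainX N G i w)) * chainDV G GQ Gη GZ N i w e +
      (chainEta N i w * (chainQ N (i + 1) e - chainQ N i e) +
        (chainQ N (i + 1) w - chainQ N i w) * chainEta N i e) +
      (GQ i (chainX N G i w) * chainQ N (i + 1) e + Gη i (chainX N G i w) * chainEta N i e) := by
  simp [chainDV, partialsCLM]
  ring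

variable {G GQ Gη GZ}

lemma hasFDerivAt_chainV
    (hG : ∀ i x, HasFDerivAt (G i) (partialsCLM (GQ i x) (Gη i x) (GZ i x)) x) (i : ℕ)
    (w : ChainSpace N) : HasFDerivAt (chainV N G i) (chainDV G GQ Gη GZ N i w) w := by
  induction i with
  | zero => exact hasFDerivAt_const _ _
  | succ i ih =>
    have h1 := ((chainEta N i).hasFDerivAt (x := w)).mul
      (((chainQ N (i + 1)).hasFDerivAt (x := w)).sub ((chainQ N i).hasFDerivAt (x := w)))
    have h2 := (hG i (chainX N G i w)).comp w
      (((chainQ N (i + 1)).hasFDerivAt (x := w)).prodMk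
        (((chainEta N i).hasFDerivAt (x := w)).prodMk ih))
    exact (ih.add h1).add h2

lemma continuous_chainX
    (hG : ∀ i x, HasFDerivAt (G i) (partialsCLM (GQ i x) (Gη i x) (GZ i x)) x) (i : ℕ) :
    Continuous (chainX N G i) := by
  have : Continuous (chainV N G i) :=
    continuous_iff_continuousAt.2 fun w => (hasFDerivAt_chainV hG i w).continuousAt
  unfold chainX
  fun_prop

lemma continuous_chainDV
    (hG : ∀ i x, HasFDerivAt (G i) (partialsCLM (GQ i x) (Gη i x) (GZ i x)) x)
    (hQ : ∀ i, Continuous (GQ i)) (hη : ∀ i, Continuous (Gη i)) (hZ : ∀ i, Continuous (GZ i))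
    (i : ℕ) : Continuous (chainDV G GQ Gη GZ N i) := by
  rw [continuous_clm_apply]
  intro e
  induction i with
  | zero => exact continuous_const
  | succ i ih =>
    simp only [chainDV_succ_apply]
    have hX := continuous_chainX (N := N) hG i
    have h1 := (hQ i).comp hX
    have h2 := (hη i).comp hX
    have h3 := (hZ i).comp hX
    simp only [Function.comp_def] at h1 h2 h3
    fun_prop

lemma abs_chainDV_le (hZ : ∀ i x, |GZ i x| ≤ 1 / 2) {m : ℕ} {w e : ChainSpace N}
    (he : ∀ i, m ≤ i → chainQ N i e = 0 ∧ chainEta N i e = 0) (k : ℕ) :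
    |chainDV G GQ Gη GZ N m w e| ≤ 2 ^ k * |chainDV G GQ Gη GZ N (m + k) w e| := by
  induction k with
  | zero => simp
  | succ k ih =>
    rw [← add_assoc, chainDV_succ_apply, (he (m + k) (by omega)).1, (he (m + k) (by omega)).2,
      (he (m + k + 1) (by omega)).1]
    simp only [sub_self, mul_zero, add_zero, abs_mul]
    have h := abs_le.1 (hZ (m + k) (chainX N G (m + k) w))
    have h1 : 1 / 2 ≤ |1 + GZ (m + k) (chainX N G (m + k) w)| := by
      rw [le_abs]; left; linarith
    have h2 := abs_nonneg (chainDV G GQ Gη GZ N (m + k) w e)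
    have h4 : |chainDV G GQ Gη GZ N (m + k) w e| ≤
        2 * (|1 + GZ (m + k) (chainX N G (m + k) w)| *
          |chainDV G GQ Gη GZ N (m + k) w e|) := by nlinarith
    calc _ ≤ 2 ^ k * |chainDV G GQ Gη GZ N (m + k) w e| := ih
      _ ≤ 2 ^ k * (2 * (|1 + GZ (m + k) (chainX N G (m + k) w)| *
          |chainDV G GQ Gη GZ N (m + k) w e|)) := by gcongr
      _ = _ := by ring

lemma chainDV_eq_zero {m : ℕ} {w e : ChainSpace N}
    (he : ∀ i, i < m → chainQ N (i + 1) e = 0 ∧ chainQ N i e = 0 ∧ chainEta N i e = 0) :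
    chainDV G GQ Gη GZ N m w e = 0 := by
  induction m with
  | zero => rfl
  | succ m ih =>
    rw [chainDV_succ_apply, ih fun i hi => he i (by omega), (he m (by omega)).1,
      (he m (by omega)).2.1, (he m (by omega)).2.2]
    simp

lemma chainQ_single_inl {j : ℕ} (hj : j < N + 1) (i : ℕ) :
    chainQ N i (EuclideanSpace.single (Sum.inl ⟨j, hj⟩) 1) = if i = j then 1 else 0 := by
  unfold chainQ
  split_ifs with h1 h2 h2
  · subst h2; simp
  · simp [h2]
  · omega
  · simp

lemma chainEta_single_inl {j : ℕ} (hj : j < N + 1) (i : ℕ) :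
    chainEta N i (EuclideanSpace.single (Sum.inl ⟨j, hj⟩) 1) = 0 := by
  unfold chainEta
  split_ifs <;> simp

lemma chainQ_single_inr {j : ℕ} (hj : j < N) (i : ℕ) :
    chainQ N i (EuclideanSpace.single (Sum.inr ⟨j, hj⟩) 1) = 0 := by
  unfold chainQ
  split_ifs <;> simp

lemma chainEta_single_inr {j : ℕ} (hj : j < N) (i : ℕ) :
    chainEta N i (EuclideanSpace.single (Sum.inr ⟨j, hj⟩) 1) = if i = j then 1 else 0 := by
  unfold chainEta
  split_ifs with h1 h2 h2
  · subst h2; simp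
  · simp [h2]
  · omega
  · simp

lemma abs_apply_single_le (φ : ChainSpace N →L[ℝ] ℝ) (k : Fin (N + 1) ⊕ Fin N) :
    |φ (EuclideanSpace.single k 1)| ≤ ‖φ‖ := by
  have := φ.le_opNorm (EuclideanSpace.single k 1)
  simpa using this

lemma abs_eta_defect_le (hZ : ∀ i x, |GZ i x| ≤ 1 / 2) {j : ℕ} (hj : j < N) (w : ChainSpace N) :
    |chainQ N (j + 1) w - chainQ N j w + Gη j (chainX N G j w)| ≤
      2 ^ N * ‖chainDV G GQ Gη GZ N N w‖ := by
  set e : ChainSpace N := EuclideanSpace.single (Sum.inr ⟨j, hj⟩) 1 with he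
  have h1 := abs_chainDV_le (G := G) (GQ := GQ) (Gη := Gη) hZ (m := j + 1) (w := w) (e := e)
    (fun i hi => ⟨chainQ_single_inr hj i, by rw [chainEta_single_inr, if_neg (by omega)]⟩)
    (N - (j + 1))
  rw [show j + 1 + (N - (j + 1)) = N by omega, chainDV_succ_apply,
    chainDV_eq_zero (fun i hi => ⟨chainQ_single_inr hj _, chainQ_single_inr hj _,
      by rw [chainEta_single_inr, if_neg (by omega)]⟩), he, chainQ_single_inr, chainQ_single_inr,
    chainEta_single_inr, if_pos rfl] at h1
  simp only [mul_zero, sub_self, mul_one, zero_add] at h1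
  refine h1.trans ?_
  gcongr
  · norm_num
  · omega
  · exact abs_apply_single_le _ _

lemma chainDV_self_single {j : ℕ} (hj : j < N + 1) (w : ChainSpace N) :
    chainDV G GQ Gη GZ N j w (EuclideanSpace.single (Sum.inl ⟨j, hj⟩) 1) = chainP N G GQ j w := by
  cases j with
  | zero => rfl
  | succ j =>
    rw [chainDV_succ_apply, chainDV_eq_zero, chainQ_single_inl, chainQ_single_inl,
      chainEta_single_inl, if_pos rfl, if_neg (by omega)]
    · simp [chainP]
    · intro i hi
      rw [chainQ_single_inl, chainQ_single_inl, if_neg (by omega), if_neg (by omega)]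
      exact ⟨rfl, rfl, chainEta_single_inl _ _⟩

lemma abs_q_defect_le (hZ : ∀ i x, |GZ i x| ≤ 1 / 2) {j : ℕ} (hj : j < N) (w : ChainSpace N) :
    |(1 + GZ j (chainX N G j w)) * chainP N G GQ j w - chainEta N j w| ≤
      2 ^ N * ‖chainDV G GQ Gη GZ N N w‖ := by
  have hj' : j < N + 1 := by omega
  set e : ChainSpace N := EuclideanSpace.single (Sum.inl ⟨j, hj'⟩) 1 with he
  have h1 := abs_chainDV_le (G := G) (GQ := GQ) (Gη := Gη) hZ (m := j + 1) (w := w) (e := e)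
    (fun i hi => ⟨by rw [chainQ_single_inl, if_neg (by omega)], chainEta_single_inl _ _⟩)
    (N - (j + 1))
  rw [show j + 1 + (N - (j + 1)) = N by omega, chainDV_succ_apply, he, chainDV_self_single,
    chainQ_single_inl, chainQ_single_inl, chainEta_single_inl, if_pos rfl,
    if_neg (by omega)] at h1
  have e1 : (1 + GZ j (chainX N G j w)) * chainP N G GQ j w +
      (chainEta N j w * (0 - 1) + (chainQ N (j + 1) w - chainQ N j w) * 0) +
      (GQ j (chainX N G j w) * 0 + Gη j (chainX N G j w) * 0) =
      (1 + GZ j (chainX N G j w)) * chainP N G GQ j w - chainEta N j w := by ring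
  rw [e1] at h1
  refine h1.trans ?_
  gcongr
  · norm_num
  · omega
  · exact abs_apply_single_le _ _

/-- Translation of all the positions. -/
def chainShift (N : ℕ) (k : ℝ) : ChainSpace N :=
  WithLp.toLp 2 (Sum.elim (fun _ => k) fun _ => 0)

lemma chainQ_shift {i : ℕ} (hi : i < N + 1) (k : ℝ) : chainQ N i (chainShift N k) = k := by
  simp [chainQ, hi, chainShift]

lemma chainEta_shift (i : ℕ) (k : ℝ) : chainEta N i (chainShift N k) = 0 := by
  unfold chainEta
  split_ifs <;> simp [chainShift]

lemma chainV_add_shift (hper : ∀ i Q η z, G i (Q + 1, η, z) = G i (Q, η, z)) (k : ℤ)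
    (w : ChainSpace N) {i : ℕ} (hi : i ≤ N) :
    chainV N G i (w + chainShift N k) = chainV N G i w := by
  have hperk : ∀ i Q η z, G i (Q + k, η, z) = G i (Q, η, z) := by
    intro i Q η z
    have : Function.Periodic (fun Q => G i (Q, η, z)) 1 := fun Q => hper i Q η z
    simpa using this.int_mul k Q
  induction i with
  | zero => rfl
  | succ i ih =>
    simp only [chainV, ih (by omega), map_add, chainQ_shift (show i + 1 < N + 1 by omega),
      chainQ_shift (show i < N + 1 by omega), chainEta_shift, add_zero, hperk]
    ring

lemma exists_bound_of_norm_chainDV_le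
    (hQb : ∀ i x, |GQ i x| ≤ 1 / 2) (hηb : ∀ i x, |Gη i x| ≤ 1 / 2)
    (hZb : ∀ i x, |GZ i x| ≤ 1 / 2) :
    ∃ R, ∀ w : ChainSpace N, ‖chainDV G GQ Gη GZ N N w‖ ≤ 1 → |chainQ N 0 w| ≤ 1 → ‖w‖ ≤ R := by
  have hP : ∀ j ≤ N, ∃ R, ∀ w : ChainSpace N, ‖chainDV G GQ Gη GZ N N w‖ ≤ 1 →
      |chainP N G GQ j w| ≤ R := by
    intro j
    induction j with
    | zero => intro _; exact ⟨0, fun w _ => by simp [chainP]⟩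
    | succ j ih =>
      intro hj
      obtain ⟨R, hR⟩ := ih (by omega)
      refine ⟨3 / 2 * R + 2 ^ N + 1 / 2, fun w hw => ?_⟩
      have h1 := hR w hw
      have h2 := (abs_q_defect_le (G := G) (GQ := GQ) (Gη := Gη) hZb (show j < N by omega) w).trans
        (mul_le_mul_of_nonneg_left hw (by positivity))
      have h3 := hQb j (chainX N G j w)
      have h4 : |GZ j (chainX N G j w) * chainP N G GQ j w| ≤ 1 / 2 * R := by
        rw [abs_mul]
        exact mul_le_mul (hZb _ _) h1 (abs_nonneg _) (by norm_num)
      simp only [chainP]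
      rw [abs_le] at *
      constructor <;> linarith [h1.1, h1.2, h2.1, h2.2, h3.1, h3.2, h4.1, h4.2]
  have hη : ∀ j < N, ∃ R, ∀ w : ChainSpace N, ‖chainDV G GQ Gη GZ N N w‖ ≤ 1 →
      |chainEta N j w| ≤ R := by
    intro j hj
    obtain ⟨R, hR⟩ := hP j hj.le
    refine ⟨3 / 2 * R + 2 ^ N, fun w hw => ?_⟩
    have h1 := hR w hw
    have h2 := (abs_q_defect_le (G := G) (GQ := GQ) (Gη := Gη) hZb hj w).trans
      (mul_le_mul_of_nonneg_left hw (by positivity))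
    have h4 : |GZ j (chainX N G j w) * chainP N G GQ j w| ≤ 1 / 2 * R := by
      rw [abs_mul]
      exact mul_le_mul (hZb _ _) h1 (abs_nonneg _) (by norm_num)
    rw [abs_le] at *
    constructor <;> linarith [h1.1, h1.2, h2.1, h2.2, h4.1, h4.2]
  have hq : ∀ j ≤ N, ∃ R, ∀ w : ChainSpace N, ‖chainDV G GQ Gη GZ N N w‖ ≤ 1 →
      |chainQ N 0 w| ≤ 1 → |chainQ N j w| ≤ R := by
    intro j
    induction j with
    | zero => intro _; exact ⟨1, fun w _ h => h⟩
    | succ j ih =>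
      intro hj
      obtain ⟨R, hR⟩ := ih (by omega)
      refine ⟨R + 2 ^ N + 1 / 2, fun w hw hw0 => ?_⟩
      have h1 := hR w hw hw0
      have h2 := (abs_eta_defect_le (G := G) (GQ := GQ) (Gη := Gη) hZb (show j < N by omega) w).trans
        (mul_le_mul_of_nonneg_left hw (by positivity))
      have h3 := hηb j (chainX N G j w)
      rw [abs_le] at *
      constructor <;> linarith [h1.1, h1.2, h2.1, h2.2, h3.1, h3.2]
  choose Rη hRη using hη
  choose Rq hRq using hq
  refine ⟨∑ k : Fin (N + 1) ⊕ Fin N, Sum.elim (fun i : Fin (N + 1) => Rq i (by omega))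
    (fun i : Fin N => Rη i i.2) k, fun w hw hw0 => ?_⟩
  have h1 : ‖w‖ ≤ ∑ k, |w k| := by
    have : w = ∑ k, w k • EuclideanSpace.single k (1 : ℝ) := by
      ext (l | l) <;> simp [Finset.sum_apply, Pi.single_apply]
    conv_lhs => rw [this]
    refine (norm_sum_le _ _).trans (Finset.sum_le_sum fun k _ => ?_)
    rw [norm_smul]; simp
  refine h1.trans (Finset.sum_le_sum ?_)
  rintro (i | i) _
  · have := hRq i (by omega) w hw hw0
    have e : chainQ N i w = w (Sum.inl i) := by
      unfold chainQ; rw [dif_pos i.2]; rfl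
    rwa [e] at this
  · have := hRη i i.2 w hw
    simpa [chainEta] using this

/-- There is no chain of positive generating functions that joins the zero section to a
Legendrian at nonpositive level. -/
theorem false_of_generating_chain (hN : 0 < N)
    (hG : ∀ i x, HasFDerivAt (G i) (partialsCLM (GQ i x) (Gη i x) (GZ i x)) x)
    (hQ : ∀ i, Continuous (GQ i)) (hη : ∀ i, Continuous (Gη i)) (hZ : ∀ i, Continuous (GZ i))
    (hQb : ∀ i x, |GQ i x| ≤ 1 / 2) (hηb : ∀ i x, |Gη i x| ≤ 1 / 2)
    (hZb : ∀ i x, |GZ i x| ≤ 1 / 2) {l u : ℝ} (hl : 0 < l) (hGl : ∀ i x, l ≤ G i x)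
    (hGu : ∀ i x, G i x ≤ u) (hper : ∀ i Q η z, G i (Q + 1, η, z) = G i (Q, η, z))
    (L : ℕ → ℝ → ℝ → ℝ → Prop) (hL0 : ∀ q, L 0 q 0 0)
    (hLs : ∀ i < N, ∀ q P z η Q, L i q P z → Q - q + Gη i (Q, η, z) = 0 →
      (1 + GZ i (Q, η, z)) * P - η = 0 →
      L (i + 1) Q (η + GQ i (Q, η, z)) (z + η * (Q - q) + G i (Q, η, z)))
    (hLN : ∀ q P z, L N q P z → z ≤ 0) : False := by
  have hcrit : ∀ w : ChainSpace N, chainDV G GQ Gη GZ N N w = 0 → chainV N G N w ≤ 0 := by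
    intro w hw
    have h : ∀ i ≤ N, L i (chainQ N i w) (chainP N G GQ i w) (chainV N G i w) := by
      intro i
      induction i with
      | zero => intro _; exact hL0 _
      | succ i ih =>
        intro hi
        have h1 := abs_eta_defect_le (G := G) (GQ := GQ) (Gη := Gη) hZb (show i < N by omega) w
        have h2 := abs_q_defect_le (G := G) (GQ := GQ) (Gη := Gη) hZb (show i < N by omega) w
        rw [hw, norm_zero, mul_zero] at h1 h2
        exact hLs i (by omega) _ _ _ _ _ (ih (by omega)) (abs_nonpos_iff.1 h1)
          (abs_nonpos_iff.1 h2)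
    exact hLN _ _ _ (h N le_rfl)
  have hS := hasFDerivAt_chainV (N := N) hG N
  have hSc : Continuous (chainV N G N) :=
    continuous_iff_continuousAt.2 fun w => (hS w).continuousAt
  have hDc := continuous_chainDV (N := N) hG hQ hη hZ N
  have hε : 0 < (N : ℝ) * l := by positivity
  obtain ⟨R, hR⟩ := exists_bound_of_norm_chainDV_le (N := N) (G := G) hQb hηb hZb
  obtain ⟨c, hc0, hc⟩ : ∃ c > 0, ∀ w : ChainSpace N, ‖w‖ ≤ R → N * l / 2 ≤ chainV N G N w →
      c ≤ ‖chainDV G GQ Gη GZ N N w‖ := by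
    have hK : IsCompact (closedBall (0 : ChainSpace N) R ∩ {w | N * l / 2 ≤ chainV N G N w}) :=
      (isCompact_closedBall _ _).inter_right (isClosed_le continuous_const hSc)
    rcases (closedBall (0 : ChainSpace N) R ∩ {w | N * l / 2 ≤ chainV N G N w}).eq_empty_or_nonempty
      with hem | hne
    · refine ⟨1, one_pos, fun w h1 h2 => ?_⟩
      have : w ∈ (∅ : Set (ChainSpace N)) := hem ▸ ⟨by simpa using h1, h2⟩
      exact this.elim
    · obtain ⟨w0, hw0, hmin⟩ := hK.exists_isMinOn hne
        (f := fun w => ‖chainDV G GQ Gη GZ N N w‖) (by fun_prop)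
      refine ⟨_, ?_, fun w h1 h2 => hmin ⟨by simpa using h1, h2⟩⟩
      rw [gt_iff_lt, norm_pos_iff]
      intro h0
      have h1 := hcrit w0 h0
      have h2 := hw0.2
      simp only [mem_ofPred_eq] at h2
      linarith
  have hgrad : ∀ w : ChainSpace N, N * l / 2 ≤ chainV N G N w →
      min 1 c ≤ ‖chainDV G GQ Gη GZ N N w‖ := by
    intro w hw
    by_cases h1 : 1 ≤ ‖chainDV G GQ Gη GZ N N w‖
    · exact (min_le_left _ _).trans h1
    push Not at h1
    set w' := w + chainShift N ((-⌊chainQ N 0 w⌋ : ℤ) : ℝ) with hw'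
    have hDV : chainDV G GQ Gη GZ N N w' = chainDV G GQ Gη GZ N N w := by
      have h2 := (hS w').comp w ((hasFDerivAt_id w).add_const
        (chainShift N ((-⌊chainQ N 0 w⌋ : ℤ) : ℝ)))
      have h3 : chainV N G N ∘ (fun x => id x + chainShift N ((-⌊chainQ N 0 w⌋ : ℤ) : ℝ)) =
          chainV N G N := by
        ext x
        exact chainV_add_shift hper _ x le_rfl
      rw [h3] at h2
      have := h2.unique (hS w)
      simpa using this
    refine (min_le_right _ _).trans ?_
    rw [← hDV]
    refine hc w' (hR w' (by rw [hDV]; exact h1.le) ?_) ?_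
    · rw [hw', map_add, chainQ_shift (by omega), Int.cast_neg, ← sub_eq_add_neg]
      rw [Int.self_sub_floor, abs_of_nonneg (Int.fract_nonneg _)]
      exact (Int.fract_lt_one _).le
    · rw [hw', chainV_add_shift hper _ _ le_rfl]; exact hw
  have hsum : ∀ (w : ChainSpace N), (∀ i, chainEta N i w * (chainQ N (i + 1) w - chainQ N i w) = 0 ∨
      N ≤ i) → ∀ i ≤ N, i * l ≤ chainV N G i w ∧ chainV N G i w ≤ i * u := by
    intro w hw i
    induction i with
    | zero => intro _; simp [chainV]
    | succ i ih =>
      intro hi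
      have h1 := ih (by omega)
      have h2 := (hw i).resolve_right (by omega)
      rw [chainV_succ, h2]
      have h3 := hGl i (chainX N G i w)
      have h4 := hGu i (chainX N G i w)
      push_cast
      constructor <;> linarith [h1.1, h1.2]
  let Pr : ChainSpace N →L[ℝ] EuclideanSpace ℝ (Fin N) := LinearMap.toContinuousLinearMap
    { toFun := fun w => WithLp.toLp 2 fun i => w (Sum.inr i)
      map_add' := fun _ _ => rfl
      map_smul' := fun _ _ => rfl }
  let s : EuclideanSpace ℝ (Fin N) →L[ℝ] ChainSpace N := LinearMap.toContinuousLinearMap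
    { toFun := fun y => WithLp.toLp 2 (Sum.elim 0 fun i => y i)
      map_add' := fun _ _ => by ext (i | i) <;> simp
      map_smul' := fun _ _ => by ext (i | i) <;> simp }
  refine false_of_linking Pr s (fun y => ?_) (S := chainV N G N)
    (g := fun w => (InnerProductSpace.toDual ℝ (ChainSpace N)).symm (chainDV G GQ Gη GZ N N w))
    (fun w => ?_) ?_ hε (B := N * u) (fun w hw => ?_) (fun y => ?_)
    (lt_min one_pos hc0) (fun w hw => ?_)
  · rfl
  · rw [hasGradientAt_iff_hasFDerivAt, LinearIsometryEquiv.apply_symm_apply]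
    exact hS w
  · exact (LinearIsometryEquiv.continuous _).comp hDc
  · refine (hsum w (fun i => ?_) N le_rfl).1
    left
    have : chainEta N i w = 0 := by
      unfold chainEta
      split_ifs with h
      · exact congrArg (fun v : EuclideanSpace ℝ (Fin N) => v ⟨i, h⟩) hw
      · rfl
    rw [this, zero_mul]
  · refine (hsum (s y) (fun i => ?_) N le_rfl).2
    left
    have : ∀ i, chainQ N i (s y) = 0 := by
      intro i
      unfold chainQ
      split_ifs with h <;> rfl
    rw [this, this, sub_zero, mul_zero]
  · rw [LinearIsometryEquiv.norm_map]
    exact hgrad w hw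

end Chain

section PositiveExtension

variable {E : Type*} [NormedAddCommGroup E] [InnerProductSpace ℝ E]

lemma abs_log_sub_log_le {a b h : ℝ} (hh : 0 < h) (ha : h ≤ a) (hb : h ≤ b) :
    |log b - log a - (b - a) / a| ≤ (b - a) ^ 2 / h ^ 2 := by
  have ha0 := hh.trans_le ha
  have hb0 := hh.trans_le hb
  rw [← Real.log_div hb0.ne' ha0.ne']
  have h1 := Real.log_le_sub_one_of_pos (div_pos hb0 ha0)
  have h2 := Real.one_sub_inv_le_log_of_pos (div_pos hb0 ha0)
  have e1 : (b - a) / a = b / a - 1 := by field_simp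
  have e2 : b / a - 1 - (1 - (b / a)⁻¹) = (b - a) ^ 2 / (a * b) := by field_simp
  have h3 : (b - a) ^ 2 / (a * b) ≤ (b - a) ^ 2 / h ^ 2 := by
    apply div_le_div_of_nonneg_left (sq_nonneg _) (by positivity)
    nlinarith
  have h4 : 0 ≤ (b - a) ^ 2 / h ^ 2 := by positivity
  rw [abs_le, e1]
  constructor <;> linarith

lemma norm_inv_smul_sub_le {a b h C r : ℝ} {u v : E} (hh : 0 < h) (ha : h ≤ a) (hb : h ≤ b)
    (hv : ‖v‖ ≤ C) (huv : ‖u - v‖ ≤ C * r) (hab : |b - a| ≤ 2 * C * r) :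
    ‖a⁻¹ • u - b⁻¹ • v‖ ≤ (C / h + 2 * C ^ 2 / h ^ 2) * r := by
  have ha0 := hh.trans_le ha
  have hb0 := hh.trans_le hb
  have hC : 0 ≤ C := (norm_nonneg _).trans hv
  have e : a⁻¹ • u - b⁻¹ • v = a⁻¹ • (u - v) + ((b - a) / (a * b)) • v := by
    have : (b - a) / (a * b) = a⁻¹ - b⁻¹ := by field_simp
    rw [this, smul_sub, sub_smul]; abel
  rw [e]
  refine (norm_add_le _ _).trans ?_
  rw [norm_smul, norm_smul, Real.norm_eq_abs, Real.norm_eq_abs, abs_of_pos (inv_pos.2 ha0),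
    abs_div, abs_of_pos (mul_pos ha0 hb0), add_mul]
  have h0 : 0 ≤ 2 * C * r := (abs_nonneg _).trans hab
  have h00 : 0 ≤ C * r := (norm_nonneg _).trans huv
  refine add_le_add ?_ ?_
  · calc a⁻¹ * ‖u - v‖ ≤ h⁻¹ * (C * r) := by gcongr
      _ = _ := by ring
  · calc |b - a| / (a * b) * ‖v‖ ≤ (2 * C * r) / (h * h) * C := by gcongr
      _ = _ := by ring

variable [FiniteDimensional ℝ E]

/-- A positive `C^{1,1}` jet extends to a positive `C^{1,1}` function, with uniform bounds. -/
theorem exists_positive_extension {h C : ℝ} (hh : 0 < h) (hC : 0 < C) :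
    ∃ B > 0, ∀ (Γ : ℝ → E) (φ : ℝ → ℝ) (D : ℝ → E) (e : E),
      (∀ x, h ≤ φ x) → (∀ x, φ x ≤ C) → (∀ x, ‖D x‖ ≤ C) →
      (∀ x y, ‖D x - D y‖ ≤ C * ‖Γ y - Γ x‖) →
      (∀ x y, |φ y - φ x - inner ℝ (D x) (Γ y - Γ x)| ≤ C * ‖Γ y - Γ x‖ ^ 2) →
      (∀ x, Γ (x + 1) = Γ x + e) → (∀ x, φ (x + 1) = φ x) → (∀ x, D (x + 1) = D x) →
      ∃ (H : E → ℝ) (g : E → E), (∀ w, HasGradientAt H (g w) w) ∧ (∀ w, exp (-B) ≤ H w) ∧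
        (∀ w, H w ≤ B) ∧ (∀ w, ‖g w‖ ≤ B) ∧ (∀ w w', ‖g w - g w'‖ ≤ B * ‖w - w'‖) ∧
        (∀ x, H (Γ x) = φ x) ∧ (∀ x, g (Γ x) = D x) ∧ ∀ w, H (w + e) = H w := by
  set L : ℝ := |log h| + |log C| with hL
  have hL0 : 0 ≤ L := by positivity
  set K : ℝ := C / h with hK
  have hK0 : 0 ≤ K := by positivity
  set M : ℝ := 4 * C ^ 2 / h ^ 2 + 2 * C ^ 2 / h ^ 2 + K + L with hM
  have hM0 : 0 ≤ M := by positivity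
  set R : ℝ := L + K + 16 * M with hR
  have hR0 : 0 ≤ R := by positivity
  set S : ℝ := K + 96 * M with hS
  have hS0 : 0 ≤ S := by positivity
  set B : ℝ := R + exp R + exp R * S + (exp R * (96 * M) + exp R * S * S) with hB
  have hB0 : 0 < B := by positivity
  refine ⟨B, hB0, ?_⟩
  intro Γ φ D e hφ1 hφ2 hD1 hD2 hφ3 hΓe hφe hDe
  have hφ0 : ∀ x, 0 < φ x := fun x => hh.trans_le (hφ1 x)
  have hφL : ∀ x y, |φ y - φ x| ≤ 2 * C * ‖Γ y - Γ x‖ := by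
    intro x y
    set r := ‖Γ y - Γ x‖ with hr
    have hr0 : 0 ≤ r := norm_nonneg _
    by_cases h1 : r ≤ 1
    · have h2 := hφ3 x y
      have h3 : |inner ℝ (D x) (Γ y - Γ x)| ≤ C * r :=
        (abs_real_inner_le_norm _ _).trans (mul_le_mul_of_nonneg_right (hD1 x) hr0)
      have h4 : C * r ^ 2 ≤ C * r := by
        apply mul_le_mul_of_nonneg_left _ hC.le
        nlinarith
      rw [← hr] at h2
      rw [abs_le] at *
      constructor <;> linarith [h2.1, h2.2, h3.1, h3.2]
    · push Not at h1
      have h2 : |φ y - φ x| ≤ C := by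
        rw [abs_le]
        constructor <;> linarith [hφ1 x, hφ1 y, hφ2 x, hφ2 y]
      nlinarith
  have hlog : ∀ x, |log (φ x)| ≤ L := by
    intro x
    have h1 := Real.log_le_log hh (hφ1 x)
    have h2 := Real.log_le_log (hφ0 x) (hφ2 x)
    rw [abs_le, hL]
    constructor <;> linarith [neg_abs_le (log h), le_abs_self (log C), abs_nonneg (log h),
      abs_nonneg (log C)]
  have hDn : ∀ x, ‖(φ x)⁻¹ • D x‖ ≤ K := by
    intro x
    rw [norm_smul, norm_inv, Real.norm_eq_abs, abs_of_pos (hφ0 x), inv_mul_eq_div, hK]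
    exact div_le_div₀ hC.le (hD1 x) hh (hφ1 x)
  let ι := ℝ ⊕ {w : E // ∀ x, 1 ≤ ‖w - Γ x‖}
  let a : ι → E := Sum.elim Γ Subtype.val
  let f : ι → ℝ := Sum.elim (fun x => log (φ x)) 0
  let d : ι → E := Sum.elim (fun x => (φ x)⁻¹ • D x) 0
  have hMs : C / h + 2 * C ^ 2 / h ^ 2 ≤ M := by
    have : 0 ≤ 4 * C ^ 2 / h ^ 2 := by positivity
    linarith
  have hfar : ∀ {r : ℝ}, 1 ≤ r → L + K * r ≤ M * r ^ 2 := by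
    intro r hr
    have h1 : r ≤ r ^ 2 := by nlinarith
    have h2 : (1 : ℝ) ≤ r ^ 2 := by nlinarith
    have h3 : L * 1 ≤ L * r ^ 2 := by gcongr
    have h4 : K * r ≤ K * r ^ 2 := by gcongr
    have h5 : 0 ≤ (4 * C ^ 2 / h ^ 2 + 2 * C ^ 2 / h ^ 2) * r ^ 2 := by positivity
    rw [hM]; linarith
  have hKM : K ≤ M := by
    have : 0 ≤ 4 * C ^ 2 / h ^ 2 := by positivity
    have : 0 ≤ 2 * C ^ 2 / h ^ 2 := by positivity
    linarith
  obtain ⟨Φ, v, hΦ, hΦa, hva, hper⟩ := exists_whitney_extension a f d hM0 (by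
    rintro (x | ⟨w, hw⟩) (y | ⟨w', hw'⟩)
    · simp only [a, f, d, Sum.elim_inl]
      have h1 := abs_log_sub_log_le hh (hφ1 x) (hφ1 y)
      have h2 := hφ3 x y
      have h3 : (φ y - φ x) ^ 2 ≤ (2 * C * ‖Γ y - Γ x‖) ^ 2 := by
        rw [← sq_abs]; gcongr; exact hφL x y
      have e1 : log (φ y) - log (φ x) - inner ℝ ((φ x)⁻¹ • D x) (Γ y - Γ x) =
          (log (φ y) - log (φ x) - (φ y - φ x) / φ x) +
          (φ y - φ x - inner ℝ (D x) (Γ y - Γ x)) / φ x := by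
        rw [inner_smul_left, conj_trivial]; ring
      rw [e1]
      refine (abs_add_le _ _).trans ?_
      rw [abs_div _ (φ x), abs_of_pos (hφ0 x)]
      have h4 : |φ y - φ x - inner ℝ (D x) (Γ y - Γ x)| / φ x ≤ C * ‖Γ y - Γ x‖ ^ 2 / h :=
        div_le_div₀ (by positivity) h2 hh (hφ1 x)
      have h5 : (φ y - φ x) ^ 2 / h ^ 2 ≤ (2 * C * ‖Γ y - Γ x‖) ^ 2 / h ^ 2 := by gcongr
      have h6 : (2 * C * ‖Γ y - Γ x‖) ^ 2 / h ^ 2 + C * ‖Γ y - Γ x‖ ^ 2 / h =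
          (4 * C ^ 2 / h ^ 2 + K) * ‖Γ y - Γ x‖ ^ 2 := by rw [hK]; ring
      have h7 : (4 * C ^ 2 / h ^ 2 + K) * ‖Γ y - Γ x‖ ^ 2 ≤ M * ‖Γ y - Γ x‖ ^ 2 := by
        gcongr
        have : 0 ≤ 2 * C ^ 2 / h ^ 2 := by positivity
        linarith
      linarith
    · simp only [a, f, d, Sum.elim_inl, Sum.elim_inr, Pi.zero_apply]
      have h1 := hlog x
      have h2 : |inner ℝ ((φ x)⁻¹ • D x) (w' - Γ x)| ≤ K * ‖w' - Γ x‖ :=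
        (abs_real_inner_le_norm _ _).trans (mul_le_mul_of_nonneg_right (hDn x) (norm_nonneg _))
      have h3 := hfar (hw' x)
      rw [abs_le] at *
      constructor <;> linarith [h1.1, h1.2, h2.1, h2.2]
    · simp only [a, f, d, Sum.elim_inl, Sum.elim_inr, Pi.zero_apply, inner_zero_left, sub_zero]
      have h1 := hlog y
      have h3 := hfar (hw y)
      rw [norm_sub_rev]
      have : 0 ≤ K * ‖w - Γ y‖ := by positivity
      linarith
    · simp [a, f, d]; positivity) (by
    rintro (x | ⟨w, hw⟩) (y | ⟨w', hw'⟩)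
    · simp only [a, d, Sum.elim_inl]
      refine (norm_inv_smul_sub_le hh (hφ1 x) (hφ1 y) (hD1 y) (hD2 x y) (hφL x y)).trans ?_
      gcongr
    · simp only [a, d, Sum.elim_inl, Sum.elim_inr, Pi.zero_apply, sub_zero]
      calc _ ≤ K := hDn x
        _ ≤ M * 1 := by linarith
        _ ≤ _ := by gcongr; exact hw' x
    · simp only [a, d, Sum.elim_inl, Sum.elim_inr, Pi.zero_apply, zero_sub, norm_neg]
      rw [norm_sub_rev]
      calc _ ≤ K := hDn y
        _ ≤ M * 1 := by linarith
        _ ≤ _ := by gcongr; exact hw y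
    · simp [a, d]; positivity)
  have hvL : ∀ w w', ‖v w - v w'‖ ≤ 96 * M * ‖w - w'‖ := fun w w' => by
    have := norm_sub_le_of_quadratic hΦ w' w
    calc _ ≤ _ := this
      _ = _ := by ring
  have hnear : ∀ w, (∃ x, ‖w - Γ x‖ ≤ 1) ∨ (Φ w = 0 ∧ v w = 0) := by
    intro w
    by_cases hw : ∀ x, 1 ≤ ‖w - Γ x‖
    · right
      exact ⟨hΦa (Sum.inr ⟨w, hw⟩), hva (Sum.inr ⟨w, hw⟩)⟩
    · left
      push Not at hw
      obtain ⟨x, hx⟩ := hw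
      exact ⟨x, hx.le⟩
  have hΦR : ∀ w, |Φ w| ≤ R := by
    intro w
    rcases hnear w with ⟨x, hx⟩ | ⟨h0, -⟩
    · have h1 := hΦ (Γ x) w
      have h2 := hlog x
      have h3 : |inner ℝ (v (Γ x)) (w - Γ x)| ≤ K * 1 := by
        refine (abs_real_inner_le_norm _ _).trans ?_
        have : v (Γ x) = (φ x)⁻¹ • D x := hva (Sum.inl x)
        rw [this]
        exact mul_le_mul (hDn x) hx (norm_nonneg _) hK0
      have h4 : Φ (Γ x) = log (φ x) := hΦa (Sum.inl x)
      have h5 : 16 * M * ‖w - Γ x‖ ^ 2 ≤ 16 * M * 1 := by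
        gcongr
        exact pow_le_one₀ (norm_nonneg _) hx
      rw [h4] at h1
      rw [abs_le] at *
      constructor <;> linarith [h1.1, h1.2, h2.1, h2.2, h3.1, h3.2]
    · rw [h0, abs_zero]; exact hR0
  have hvS : ∀ w, ‖v w‖ ≤ S := by
    intro w
    rcases hnear w with ⟨x, hx⟩ | ⟨-, h0⟩
    · have h1 := hvL w (Γ x)
      have h2 : ‖v (Γ x)‖ ≤ K := by
        have : v (Γ x) = (φ x)⁻¹ • D x := hva (Sum.inl x)
        rw [this]; exact hDn x
      calc ‖v w‖ = ‖v (Γ x) + (v w - v (Γ x))‖ := by rw [add_sub_cancel]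
        _ ≤ K + 96 * M * ‖w - Γ x‖ := (norm_add_le _ _).trans (add_le_add h2 h1)
        _ ≤ K + 96 * M * 1 := by gcongr
        _ = S := by rw [mul_one]
    · rw [h0, norm_zero]; exact hS0
  have hgrad : ∀ w, HasGradientAt Φ (v w) w := fun w => hasGradientAt_of_quadratic (hΦ w)
  have hexp : ∀ w, exp (Φ w) ≤ exp R := fun w => exp_le_exp.2 ((le_abs_self _).trans (hΦR w))
  have hHg : ∀ w, HasFDerivAt (fun w => exp (Φ w))
      (InnerProductSpace.toDual ℝ E (exp (Φ w) • v w)) w := by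
    intro w
    rw [map_smulₛₗ, conj_trivial]
    exact (hgrad w).hasFDerivAt.exp
  have hgS : ∀ w, ‖exp (Φ w) • v w‖ ≤ exp R * S := by
    intro w
    rw [norm_smul, Real.norm_eq_abs, abs_of_pos (exp_pos _)]
    exact mul_le_mul (hexp w) (hvS w) (norm_nonneg _) (exp_pos _).le
  have hp1 := exp_pos R
  have hp2 : 0 ≤ exp R * S := by positivity
  have hp3 : 0 ≤ exp R * (96 * M) := by positivity
  have hp4 : 0 ≤ exp R * S * S := by positivity
  have hHL : ∀ w w', |exp (Φ w) - exp (Φ w')| ≤ exp R * S * ‖w - w'‖ := by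
    intro w w'
    exact convex_univ.norm_image_sub_le_of_norm_hasFDerivWithin_le
      (f := fun w => exp (Φ w)) (fun x _ => (hHg x).hasFDerivWithinAt)
      (fun x _ => by rw [LinearIsometryEquiv.norm_map]; exact hgS x) (mem_univ w') (mem_univ w)
  refine ⟨fun w => exp (Φ w), fun w => exp (Φ w) • v w, hHg, fun w => ?_, fun w => ?_,
    fun w => ?_, fun w w' => ?_, fun x => ?_, fun x => ?_, fun w => ?_⟩
  · refine exp_le_exp.2 ?_
    have := (abs_le.1 (hΦR w)).1
    linarith
  · linarith [hexp w]
  · linarith [hgS w]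
  · have e1 : exp (Φ w) • v w - exp (Φ w') • v w' =
        exp (Φ w) • (v w - v w') + (exp (Φ w) - exp (Φ w')) • v w' := by
      rw [smul_sub, sub_smul]; abel
    simp only
    rw [e1]
    refine (norm_add_le _ _).trans ?_
    rw [norm_smul, norm_smul, Real.norm_eq_abs, Real.norm_eq_abs, abs_of_pos (exp_pos _)]
    have h1 : exp (Φ w) * ‖v w - v w'‖ ≤ exp R * (96 * M * ‖w - w'‖) := by
      gcongr
      · exact (le_abs_self _).trans (hΦR w)
      · exact hvL w w'
    have h2 : |exp (Φ w) - exp (Φ w')| * ‖v w'‖ ≤ exp R * S * ‖w - w'‖ * S := by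
      gcongr
      · exact hHL w w'
      · exact hvS w'
    have h3 : (exp R * (96 * M) + exp R * S * S) * ‖w - w'‖ ≤ B * ‖w - w'‖ := by
      gcongr
      linarith
    linarith
  · have : Φ (Γ x) = log (φ x) := hΦa (Sum.inl x)
    simp only
    rw [this, exp_log (hφ0 x)]
  · have h1 : Φ (Γ x) = log (φ x) := hΦa (Sum.inl x)
    have h2 : v (Γ x) = (φ x)⁻¹ • D x := hva (Sum.inl x)
    simp only
    rw [h1, h2, exp_log (hφ0 x), smul_smul, mul_inv_cancel₀ (hφ0 x).ne', one_smul]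
  · have hΓs : ∀ x, Γ (x - 1) = Γ x - e := fun x => by
      rw [eq_sub_iff_add_eq, ← hΓe, sub_add_cancel]
    have h1 : ∀ w, Φ (w + e) ≤ Φ w := by
      refine hper e ?_
      rintro (x | ⟨w, hw⟩)
      · exact ⟨Sum.inl (x + 1), hΓe x, by simp [f, hφe], by simp [d, hφe, hDe]⟩
      · refine ⟨Sum.inr ⟨w + e, fun x => ?_⟩, rfl, rfl, rfl⟩
        have := hw (x - 1)
        rw [hΓs] at this
        have e2 : w + e - Γ x = w - (Γ x - e) := by abel
        rwa [e2]
    have h2 : ∀ w, Φ (w + -e) ≤ Φ w := by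
      refine hper (-e) ?_
      rintro (x | ⟨w, hw⟩)
      · have hφ' : φ (x - 1) = φ x := by rw [← hφe, sub_add_cancel]
        have hD' : D (x - 1) = D x := by rw [← hDe, sub_add_cancel]
        refine ⟨Sum.inl (x - 1), ?_, by simp [f, hφ'], by simp [d, hφ', hD']⟩
        simp only [a, Sum.elim_inl]
        rw [hΓs, sub_eq_add_neg]
      · refine ⟨Sum.inr ⟨w + -e, fun x => ?_⟩, rfl, rfl, rfl⟩
        have := hw (x + 1)
        rw [hΓe] at this
        have e2 : w + -e - Γ x = w - (Γ x + e) := by abel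
        rwa [e2]
    have h3 := h2 (w + e)
    rw [add_neg_cancel_right] at h3
    simp only
    rw [le_antisymm (h1 w) h3]

end PositiveExtension

section Strip

variable {X : Type*} [NormedAddCommGroup X] [NormedSpace ℝ X]

/-- The strip `[0,1] × ℝ`. -/
abbrev strip : Set (ℝ × ℝ) := Icc (0 : ℝ) 1 ×ˢ univ

lemma convex_strip : Convex ℝ strip := (convex_Icc 0 1).prod convex_univ

lemma uniqueDiffOn_strip : UniqueDiffOn ℝ strip :=
  (uniqueDiffOn_Icc zero_lt_one).prod uniqueDiffOn_univ

lemma fderivWithin_strip_add_one {g : ℝ × ℝ → X} (hg : DifferentiableOn ℝ g strip) {k : X}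
    (hper : ∀ t ∈ Icc (0 : ℝ) 1, ∀ x, g (t, x + 1) = g (t, x) + k) {t : ℝ}
    (ht : t ∈ Icc (0 : ℝ) 1) (x : ℝ) :
    fderivWithin ℝ g strip (t, x + 1) = fderivWithin ℝ g strip (t, x) := by
  have hmem : ∀ y, ((t, y) : ℝ × ℝ) ∈ strip := fun y => ⟨ht, mem_univ _⟩
  have h1 := (hg _ (hmem (x + 1))).hasFDerivWithinAt
  have h2 : HasFDerivWithinAt (fun w : ℝ × ℝ => w + (0, 1)) (ContinuousLinearMap.id ℝ (ℝ × ℝ))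
      strip (t, x) := ((hasFDerivAt_id _).add_const _).hasFDerivWithinAt
  have e1 : ((t, x) : ℝ × ℝ) + (0, 1) = (t, x + 1) := by simp
  rw [← e1] at h1
  have hmaps : MapsTo (fun w : ℝ × ℝ => w + (0, 1)) strip strip := fun w hw =>
    ⟨by simpa using hw.1, mem_univ _⟩
  have h3 := HasFDerivWithinAt.comp (g := g) (t := strip) (t, x) h1 h2 hmaps
  have h4 : HasFDerivWithinAt (fun w => g w + k) (fderivWithin ℝ g strip ((t, x) + (0, 1)))
      strip (t, x) := by
    refine h3.congr (fun w hw => ?_) ?_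
    · have := hper w.1 hw.1 w.2
      simp only [Function.comp]
      rw [← this]
      congr 1
      ext <;> simp
    · simp only [Function.comp]
      rw [e1, hper t ht]
  have h5 := (hg _ (hmem x)).hasFDerivWithinAt.add_const k
  rw [← e1]
  exact (uniqueDiffOn_strip _ (hmem x)).eq h4 h5

lemma exists_lipschitz_strip {g : ℝ × ℝ → X} (hg : ContDiffOn ℝ 1 g strip) {k : X}
    (hper : ∀ t ∈ Icc (0 : ℝ) 1, ∀ x, g (t, x + 1) = g (t, x) + k) :
    ∃ C, 0 ≤ C ∧ ∀ a ∈ strip, ∀ b ∈ strip, ‖g b - g a‖ ≤ C * ‖b - a‖ := by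
  have hc := hg.continuousOn_fderivWithin uniqueDiffOn_strip le_rfl
  have hcomp : IsCompact (Icc (0 : ℝ) 1 ×ˢ Icc (0 : ℝ) 1) := isCompact_Icc.prod isCompact_Icc
  obtain ⟨C, hC⟩ := hcomp.exists_bound_of_continuousOn
    (hc.mono (prod_mono_right (subset_univ _)))
  have hdiff := hg.differentiableOn one_ne_zero
  have hb : ∀ a ∈ strip, ‖fderivWithin ℝ g strip a‖ ≤ C := by
    rintro ⟨t, x⟩ ⟨ht, -⟩
    have hp : Function.Periodic (fun x => fderivWithin ℝ g strip (t, x)) 1 := fun x =>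
      fderivWithin_strip_add_one hdiff hper ht x
    obtain ⟨y, hy, hxy⟩ := hp.exists_mem_Ico₀ one_pos x
    rw [hxy]
    exact hC _ ⟨ht, Ico_subset_Icc_self hy⟩
  have hC0 : 0 ≤ C := (norm_nonneg _).trans (hb (0, 0) ⟨by simp, mem_univ _⟩)
  exact ⟨C, hC0, fun a ha b hb' => convex_strip.norm_image_sub_le_of_norm_hasFDerivWithin_le
    (fun w hw => (hdiff w hw).hasFDerivWithinAt) hb ha hb'⟩

lemma exists_hasDerivAt_strip {g : ℝ × ℝ → X} (hg : ContDiffOn ℝ 2 g strip) {k : X}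
    (hper : ∀ t ∈ Icc (0 : ℝ) 1, ∀ x, g (t, x + 1) = g (t, x) + k) :
    ∃ g' : ℝ × ℝ → X, ContDiffOn ℝ 1 g' strip ∧
      (∀ t ∈ Icc (0 : ℝ) 1, ∀ x, g' (t, x + 1) = g' (t, x)) ∧
      ∀ t ∈ Icc (0 : ℝ) 1, ∀ x, HasDerivAt (fun y => g (t, y)) (g' (t, x)) x := by
  have hdiff := hg.differentiableOn two_ne_zero
  refine ⟨fun w => fderivWithin ℝ g strip w (0, 1), ?_, ?_, ?_⟩
  · exact (hg.fderivWithin uniqueDiffOn_strip (m := 1) (by norm_num)).clm_apply contDiffOn_const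
  · intro t ht x
    simp only
    rw [fderivWithin_strip_add_one hdiff hper ht x]
  · intro t ht x
    have h1 := (hdiff (t, x) ⟨ht, mem_univ _⟩).hasFDerivWithinAt
    have h2 : HasDerivWithinAt (fun y : ℝ => ((t, y) : ℝ × ℝ)) (0, 1) univ x :=
      ((hasDerivAt_const x t).prodMk (hasDerivAt_id x)).hasDerivWithinAt
    have hmaps : MapsTo (fun y : ℝ => ((t, y) : ℝ × ℝ)) univ strip := fun y _ => ⟨ht, mem_univ _⟩
    have h3 := HasFDerivWithinAt.comp_hasDerivWithinAt (t := strip) x h1 h2 hmaps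
    exact h3.hasDerivAt univ_mem

end Strip

section Bounds

variable {w : ℝ × ℝ → ℝ × ℝ × ℝ}

lemma norm_sub_sub_le_of_deriv {X : Type*} [NormedAddCommGroup X] [NormedSpace ℝ X]
    {f f' : ℝ → X} {C : ℝ} (hf : ∀ x, HasDerivAt f (f' x) x)
    (hC : ∀ x, ‖f' x‖ ≤ C) (x y : ℝ) : ‖f y - f x‖ ≤ C * |y - x| :=
  convex_univ.norm_image_sub_le_of_norm_hasDerivWithin_le
    (fun x _ => (hf x).hasDerivWithinAt) (fun x _ => hC x) (mem_univ x) (mem_univ y)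

lemma norm_sub_le_mul_sq {X : Type*} [NormedAddCommGroup X] [NormedSpace ℝ X]
    {f f' : ℝ → X} {K x : ℝ} (hK : 0 ≤ K) (hf : ∀ y, HasDerivAt f (f' y) y)
    (hb : ∀ y, ‖f' y‖ ≤ K * |y - x|) (y : ℝ) : ‖f y - f x‖ ≤ K * |y - x| ^ 2 := by
  have h := (convex_closedBall x |y - x|).norm_image_sub_le_of_norm_hasDerivWithin_le
    (f := f) (f' := f') (C := K * |y - x|) (x := x) (y := y)
    (fun s _ => (hf s).hasDerivWithinAt) (fun s hs => ?_) (by simp) (by simp [dist_eq_norm])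
  · calc _ ≤ K * |y - x| * ‖y - x‖ := h
      _ = _ := by rw [Real.norm_eq_abs]; ring
  · have h1 : |s - x| ≤ |y - x| := by simpa [dist_eq_norm] using hs
    exact (hb s).trans (by gcongr)

lemma norm_taylor_le {X : Type*} [NormedAddCommGroup X] [NormedSpace ℝ X]
    {f f' : ℝ → X} {C : ℝ} (hC0 : 0 ≤ C) (hf : ∀ x, HasDerivAt f (f' x) x)
    (hC : ∀ x y, ‖f' y - f' x‖ ≤ C * |y - x|) (x y : ℝ) :
    ‖f y - f x - (y - x) • f' x‖ ≤ C * |y - x| ^ 2 := by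
  have h := norm_sub_le_mul_sq (f := fun s => f s - (s - x) • f' x) (f' := fun s => f' s - f' x)
    hC0 (fun s => ?_) (hC x) y
  · rwa [sub_self, zero_smul, sub_zero, sub_right_comm] at h
  · have h1 := (((hasDerivAt_id s).sub_const x).smul_const (f' x))
    rw [one_smul] at h1
    exact (hf s).sub h1

/-- Uniform bi-Lipschitz bound for an isotopy of embedded equivariant curves. -/
lemma exists_bilipschitz {w' : ℝ × ℝ → ℝ × ℝ × ℝ} (hc : ContinuousOn w strip)
    (hc' : ContinuousOn w' strip)
    (hper : ∀ t ∈ Icc (0 : ℝ) 1, ∀ x, w (t, x + 1) = w (t, x) + (1, 0, 0))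
    (hper' : ∀ t ∈ Icc (0 : ℝ) 1, ∀ x, w' (t, x + 1) = w' (t, x))
    (hd : ∀ t ∈ Icc (0 : ℝ) 1, ∀ x, HasDerivAt (fun y => w (t, y)) (w' (t, x)) x)
    (hne : ∀ t ∈ Icc (0 : ℝ) 1, ∀ x, w' (t, x) ≠ 0)
    (hinj : ∀ t ∈ Icc (0 : ℝ) 1, ∀ x y, w (t, x) = w (t, y) → x = y)
    {C : ℝ} (hC0 : 0 ≤ C)
    (hC' : ∀ t ∈ Icc (0 : ℝ) 1, ∀ x y, ‖w' (t, y) - w' (t, x)‖ ≤ C * |y - x|)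
    (hCt : ∀ t ∈ Icc (0 : ℝ) 1, ∀ x, |(w (t, x)).1 - x| ≤ C) :
    ∃ c > 0, ∀ t ∈ Icc (0 : ℝ) 1, ∀ x y, c * |x - y| ≤ ‖w (t, x) - w (t, y)‖ := by
  obtain ⟨m, hm0, hm⟩ : ∃ m > 0, ∀ t ∈ Icc (0 : ℝ) 1, ∀ x, m ≤ ‖w' (t, x)‖ := by
    have hcomp : IsCompact (Icc (0 : ℝ) 1 ×ˢ Icc (0 : ℝ) 1) := isCompact_Icc.prod isCompact_Icc
    obtain ⟨a, ha, hmin⟩ := hcomp.exists_isMinOn ⟨(0, 0), by simp⟩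
      (f := fun a => ‖w' a‖) (hc'.mono (prod_mono_right (subset_univ _))).norm
    refine ⟨‖w' a‖, norm_pos_iff.2 (hne a.1 ha.1 a.2), fun t ht x => ?_⟩
    have hp : Function.Periodic (fun x => w' (t, x)) 1 := fun x => hper' t ht x
    obtain ⟨y, hy, hxy⟩ := hp.exists_mem_Ico₀ one_pos x
    rw [hxy]
    exact hmin ⟨ht, Ico_subset_Icc_self hy⟩
  set r : ℝ := m / (2 * (C + 1)) with hr
  have hr0 : 0 < r := by positivity
  set R : ℝ := 4 * C + 1 with hR
  have hR0 : 0 < R := by positivity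
  obtain ⟨μ, hμ0, hμ⟩ : ∃ μ > 0, ∀ t ∈ Icc (0 : ℝ) 1, ∀ u y, r ≤ |u| → |u| ≤ R →
      μ ≤ ‖w (t, y + u) - w (t, y)‖ := by
    set K : Set (ℝ × ℝ × ℝ) := (Icc (0 : ℝ) 1 ×ˢ (Icc (0 : ℝ) 1 ×ˢ closedBall 0 R)) ∩
      {a | r ≤ |a.2.2|} with hK
    have hKc : IsCompact K := (isCompact_Icc.prod
      (isCompact_Icc.prod (isCompact_closedBall 0 R))).inter_right
        (isClosed_le continuous_const (by fun_prop))
    have hfc : ContinuousOn (fun a : ℝ × ℝ × ℝ => ‖w (a.1, a.2.1 + a.2.2) - w (a.1, a.2.1)‖) K := by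
      refine ContinuousOn.norm (ContinuousOn.sub ?_ ?_)
      · exact hc.comp (by fun_prop) fun a ha => ⟨ha.1.1, mem_univ _⟩
      · exact hc.comp (by fun_prop) fun a ha => ⟨ha.1.1, mem_univ _⟩
    obtain ⟨μ, hμ0, hμ⟩ : ∃ μ > 0, ∀ a ∈ K, μ ≤ ‖w (a.1, a.2.1 + a.2.2) - w (a.1, a.2.1)‖ := by
      rcases K.eq_empty_or_nonempty with hem | hne
      · exact ⟨1, one_pos, fun a ha => by rw [hem] at ha; exact ha.elim⟩
      · obtain ⟨a, ha, hmin⟩ := hKc.exists_isMinOn hne hfc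
        refine ⟨_, ?_, fun b hb => hmin hb⟩
        rw [gt_iff_lt, norm_pos_iff, sub_ne_zero]
        intro h
        have h1 := hinj _ ha.1.1 _ _ h
        have h2 : r ≤ |a.2.2| := ha.2
        rw [add_eq_left.1 h1, abs_zero] at h2
        linarith
    refine ⟨μ, hμ0, fun t ht u y hu1 hu2 => ?_⟩
    have hp : Function.Periodic (fun y => w (t, y + u) - w (t, y)) 1 := fun y => by
      simp only
      rw [show y + 1 + u = y + u + 1 by ring, hper t ht, hper t ht, add_sub_add_right_eq_sub]
    obtain ⟨y', hy', hyy⟩ := hp.exists_mem_Ico₀ one_pos y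
    rw [hyy]
    exact hμ (t, y', u) ⟨⟨ht, Ico_subset_Icc_self hy', by simpa using hu2⟩, hu1⟩
  refine ⟨min (m / 2) (min (μ / R) (1 / 2)), by positivity, fun t ht x y => ?_⟩
  by_cases h1 : |x - y| ≤ r
  · have h2 := norm_taylor_le hC0 (hd t ht) (hC' t ht) y x
    have h3 : |x - y| * m ≤ ‖(x - y) • w' (t, y)‖ := by
      rw [norm_smul, Real.norm_eq_abs]
      gcongr
      exact hm t ht y
    have h4 := norm_sub_norm_le ((x - y) • w' (t, y)) (w (t, x) - w (t, y))
    rw [norm_sub_rev ((x - y) • w' (t, y)) (w (t, x) - w (t, y))] at h4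
    have h5 : C * |x - y| ≤ m / 2 := by
      calc C * |x - y| ≤ (C + 1) * r := by gcongr; linarith
        _ = m / 2 := by rw [hr]; field_simp
    have h6 : C * |x - y| ^ 2 ≤ m / 2 * |x - y| := by
      rw [pow_two, ← mul_assoc]; gcongr
    calc _ ≤ m / 2 * |x - y| := by gcongr; exact min_le_left _ _
      _ ≤ _ := by linarith
  · push Not at h1
    by_cases h2 : |x - y| ≤ R
    · have h3 := hμ t ht (x - y) y h1.le h2
      rw [add_sub_cancel] at h3
      calc _ ≤ μ / R * |x - y| := by
            gcongr; exact (min_le_right _ _).trans (min_le_left _ _)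
        _ ≤ μ / R * R := by gcongr
        _ = μ := by field_simp
        _ ≤ _ := h3
    · push Not at h2
      have h3 : |(w (t, x) - w (t, y)).1| ≤ ‖w (t, x) - w (t, y)‖ := by
        rw [← Real.norm_eq_abs]; exact norm_fst_le _
      have h4 : |x - y| - 2 * C ≤ |(w (t, x) - w (t, y)).1| := by
        have e : x - y = (w (t, x) - w (t, y)).1 - ((w (t, x)).1 - x) + ((w (t, y)).1 - y) := by
          simp only [Prod.fst_sub]; ring
        have h5 := abs_add_le ((w (t, x) - w (t, y)).1 - ((w (t, x)).1 - x)) ((w (t, y)).1 - y)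
        have h6 := abs_sub (w (t, x) - w (t, y)).1 ((w (t, x)).1 - x)
        rw [← e] at h5
        linarith [hCt t ht x, hCt t ht y]
      calc _ ≤ 1 / 2 * |x - y| := by
            gcongr; exact (min_le_right _ _).trans (min_le_right _ _)
        _ ≤ _ := by linarith

end Bounds

section Link

/-- The identification of `ℝ × ℝ × ℝ` with Euclidean space. -/
def toEuclid : ℝ × ℝ × ℝ →L[ℝ] EuclideanSpace ℝ (Fin 3) :=
  LinearMap.toContinuousLinearMap
    { toFun := fun a => !₂[a.1, a.2.1, a.2.2]
      map_add' := fun a b => by ext i; fin_cases i <;> simp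
      map_smul' := fun r a => by ext i; fin_cases i <;> simp }

lemma toEuclid_apply (a : ℝ × ℝ × ℝ) : toEuclid a = !₂[a.1, a.2.1, a.2.2] := rfl

lemma norm_le_norm_toEuclid (a : ℝ × ℝ × ℝ) : ‖a‖ ≤ ‖toEuclid a‖ := by
  have h : ∀ i, ‖toEuclid a i‖ ≤ ‖toEuclid a‖ := fun i => PiLp.norm_apply_le _ i
  rw [Prod.norm_def, Prod.norm_def]
  exact max_le (h 0) (max_le (h 1) (h 2))

lemma norm_toEuclid_le (a : ℝ × ℝ × ℝ) : ‖toEuclid a‖ ≤ |a.1| + |a.2.1| + |a.2.2| := by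
  rw [EuclideanSpace.norm_eq]
  apply Real.sqrt_le_iff.2
  refine ⟨by positivity, ?_⟩
  simp only [Fin.sum_univ_three, toEuclid_apply, Real.norm_eq_abs]
  simp
  have h1 := abs_nonneg a.1
  have h2 := abs_nonneg a.2.1
  have h3 := abs_nonneg a.2.2
  rw [← sq_abs a.1, ← sq_abs a.2.1, ← sq_abs a.2.2]
  nlinarith [mul_nonneg h1 h2, mul_nonneg h1 h3, mul_nonneg h2 h3]

lemma inner_toEuclid (g : EuclideanSpace ℝ (Fin 3)) (a : ℝ × ℝ × ℝ) :
    inner ℝ g (toEuclid a) = g 0 * a.1 + g 1 * a.2.1 + g 2 * a.2.2 := by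
  simp [PiLp.inner_apply, Fin.sum_univ_three, toEuclid_apply]
  ring

/-- Two consecutive Legendrians of a finely subdivided positive isotopy are related by a
positive generating function. -/
lemma exists_link {h C c : ℝ} (hh : 0 < h) (hC : 0 < C) (hc : 0 < c) :
    ∃ B > 0, ∀ δ > 0, C * δ ≤ c / 2 → δ * B * (1 + C) < 1 → ∀ q p z qh ph zh q' p' qh' ph' : ℝ → ℝ,
      (∀ x, HasDerivAt q (q' x) x) → (∀ x, HasDerivAt p (p' x) x) →
      (∀ x, HasDerivAt z (p x * q' x) x) → (∀ x, HasDerivAt qh (qh' x) x) →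
      (∀ x, HasDerivAt ph (ph' x) x) → (∀ x, HasDerivAt zh (ph x * qh' x) x) →
      (∀ x, |p' x| ≤ C) → (∀ x, |qh' x| ≤ C) →
      (∀ x, |qh' x - q' x| ≤ C * δ) → (∀ x, |ph' x - p' x| ≤ C * δ) →
      (∀ x, |qh x - q x| ≤ C * δ) → (∀ x, |ph x - p x| ≤ C * δ) →
      (∀ x, |zh x - z x| ≤ C * δ) → (∀ x, |p x| ≤ C) →
      (∀ x, h * δ ≤ zh x - z x - p x * (qh x - q x)) →
      (∀ x y, c * |x - y| ≤ ‖((q x, p x, z x) : ℝ × ℝ × ℝ) - (q y, p y, z y)‖) →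
      (∀ x, q (x + 1) = q x + 1) → (∀ x, p (x + 1) = p x) → (∀ x, z (x + 1) = z x) →
      (∀ x, qh (x + 1) = qh x + 1) → (∀ x, ph (x + 1) = ph x) → (∀ x, zh (x + 1) = zh x) →
      ∃ G GQ Gη GZ : ℝ × ℝ × ℝ → ℝ,
        (∀ a, HasFDerivAt G (partialsCLM (GQ a) (Gη a) (GZ a)) a) ∧
        Continuous GQ ∧ Continuous Gη ∧ Continuous GZ ∧
        (∀ a, |GQ a| ≤ δ * B) ∧ (∀ a, |Gη a| ≤ δ * B) ∧ (∀ a, |GZ a| ≤ δ * B) ∧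
        (∀ a, δ * exp (-B) ≤ G a) ∧ (∀ a, G a ≤ δ * B) ∧
        (∀ Q η Z, G (Q + 1, η, Z) = G (Q, η, Z)) ∧
        ∀ x η Q, Q - q x + Gη (Q, η, z x) = 0 → (1 + GZ (Q, η, z x)) * p x - η = 0 →
          Q = qh x ∧ η + GQ (Q, η, z x) = ph x ∧ z x + η * (Q - q x) + G (Q, η, z x) = zh x := by
  set C' : ℝ := 2 * C + C * C + 4 * C / c + 2 * C * C * (4 / c ^ 2) with hC'
  have hC'0 : 0 < C' := by positivity
  obtain ⟨B, hB, hext⟩ := exists_positive_extension (E := EuclideanSpace ℝ (Fin 3)) hh hC'0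
  refine ⟨B, hB, ?_⟩
  intro δ hδ hδc hδB q p z qh ph zh q' p' qh' ph' dq dp dz dqh dph dzh bp' bqh' bq'd bp'd
    bq bp bz bpC hpos hlow perq perp perz perqh perph perzh
  set Γ : ℝ → EuclideanSpace ℝ (Fin 3) := fun x => toEuclid (qh x, p x, z x) with hΓ
  set u : ℝ → ℝ := fun x => (ph x - p x) / δ with hu
  set v : ℝ → ℝ := fun x => (q x - qh x) / δ with hv
  set φ : ℝ → ℝ := fun x => (zh x - z x - p x * (qh x - q x)) / δ with hφ
  set D : ℝ → EuclideanSpace ℝ (Fin 3) := fun x => toEuclid (u x, v x, 0) with hD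
  have bu : ∀ x, |u x| ≤ C := fun x => by
    rw [hu]; simp only; rw [abs_div, abs_of_pos hδ, div_le_iff₀ hδ]; exact bp x
  have bv : ∀ x, |v x| ≤ C := fun x => by
    rw [hv]; simp only; rw [abs_div, abs_of_pos hδ, div_le_iff₀ hδ, abs_sub_comm]; exact bq x
  have lu : ∀ x y, |u y - u x| ≤ C * |y - x| := fun x y => by
    refine norm_sub_sub_le_of_deriv (f := u) (f' := fun x => (ph' x - p' x) / δ)
      (fun x => ((dph x).sub (dp x)).div_const δ) (fun x => ?_) x y
    rw [Real.norm_eq_abs, abs_div, abs_of_pos hδ, div_le_iff₀ hδ]; exact bp'd x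
  have lv : ∀ x y, |v y - v x| ≤ C * |y - x| := fun x y => by
    refine norm_sub_sub_le_of_deriv (f := v) (f' := fun x => (q' x - qh' x) / δ)
      (fun x => ((dq x).sub (dqh x)).div_const δ) (fun x => ?_) x y
    rw [Real.norm_eq_abs, abs_div, abs_of_pos hδ, div_le_iff₀ hδ, abs_sub_comm]; exact bq'd x
  have dφ : ∀ x, HasDerivAt φ (u x * qh' x + v x * p' x) x := fun x => by
    have := (((dzh x).sub (dz x)).sub ((dp x).mul ((dqh x).sub (dq x)))).div_const δ
    refine this.congr_deriv ?_
    simp only [hu, hv, Pi.sub_apply]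
    field_simp
    ring
  have hΓlow : ∀ x y, c / 2 * |x - y| ≤ ‖Γ x - Γ y‖ := fun x y => by
    have h1 : ‖((qh x, p x, z x) : ℝ × ℝ × ℝ) - (qh y, p y, z y)‖ ≤ ‖Γ x - Γ y‖ := by
      rw [hΓ]; simp only; rw [← map_sub]; exact norm_le_norm_toEuclid _
    have h2 : ((q x, p x, z x) : ℝ × ℝ × ℝ) - (q y, p y, z y) =
        ((qh x, p x, z x) - (qh y, p y, z y)) + (δ * (v x - v y), 0, 0) := by
      simp only [Prod.mk_sub_mk, Prod.mk_add_mk, hv, add_zero, Prod.mk.injEq, and_true]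
      field_simp
      ring
    have h3 := hlow x y
    rw [h2] at h3
    have h4 := norm_add_le (((qh x, p x, z x) : ℝ × ℝ × ℝ) - (qh y, p y, z y))
      (δ * (v x - v y), 0, 0)
    have h5 : ‖((δ * (v x - v y), 0, 0) : ℝ × ℝ × ℝ)‖ ≤ c / 2 * |x - y| := by
      have e : ‖((δ * (v x - v y), 0, 0) : ℝ × ℝ × ℝ)‖ = δ * |v x - v y| := by
        rw [Prod.norm_def, Prod.norm_def]
        simp [abs_of_pos hδ]
        positivity
      rw [e]
      calc δ * |v x - v y| ≤ δ * (C * |x - y|) := by gcongr; exact lv y x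
        _ = C * δ * |x - y| := by ring
        _ ≤ _ := by gcongr
    linarith
  have hΓlow' : ∀ x y, |y - x| ≤ 2 / c * ‖Γ y - Γ x‖ := fun x y => by
    have := hΓlow y x
    rw [div_mul_eq_mul_div, le_div_iff₀ hc]
    linarith
  obtain ⟨H, g, hgrad, hHl, hHu, hgb, hgl, hHΓ, hgΓ, hHper⟩ := hext Γ φ D (toEuclid (1, 0, 0))
    (fun x => by rw [hφ]; simp only; rw [le_div_iff₀ hδ]; exact hpos x)
    (fun x => by
      have h1 : φ x ≤ C + C * C := by
        rw [hφ]; simp only; rw [div_le_iff₀ hδ]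
        have e1 := (abs_le.1 (bz x)).2
        have e2 : |p x * (qh x - q x)| ≤ C * (C * δ) := by
          rw [abs_mul]; exact mul_le_mul (bpC x) (bq x) (abs_nonneg _) hC.le
        have := (abs_le.1 e2).1
        nlinarith
      refine h1.trans ?_
      have : 0 < 4 * C / c := by positivity
      have : 0 < 2 * C * C * (4 / c ^ 2) := by positivity
      linarith)
    (fun x => by
      have h1 : ‖D x‖ ≤ 2 * C := by
        refine (norm_toEuclid_le _).trans ?_
        have := bu x; have := bv x
        simp only [abs_zero]; linarith
      refine h1.trans ?_
      have : 0 < 4 * C / c := by positivity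
      have : 0 < 2 * C * C * (4 / c ^ 2) := by positivity
      have : 0 < C * C := by positivity
      linarith)
    (fun x y => by
      have h1 : ‖D x - D y‖ ≤ 2 * C * |y - x| := by
        simp only [hD]
        rw [← map_sub]
        refine (norm_toEuclid_le _).trans ?_
        have h1 := lu y x; have h2 := lv y x
        rw [abs_sub_comm x y] at h1 h2
        simp only [Prod.mk_sub_mk, sub_self, abs_zero]; linarith
      calc _ ≤ 2 * C * |y - x| := h1
        _ ≤ 2 * C * (2 / c * ‖Γ y - Γ x‖) := by gcongr; exact hΓlow' x y
        _ = 4 * C / c * ‖Γ y - Γ x‖ := by ring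
        _ ≤ _ := by
          gcongr
          have : 0 < 2 * C * C * (4 / c ^ 2) := by positivity
          have : 0 < C * C := by positivity
          linarith)
    (fun x y => by
      have h1 := norm_sub_le_mul_sq (f := fun s => φ s - (u x * qh s + v x * p s))
        (f' := fun s => (u s * qh' s + v s * p' s) - (u x * qh' s + v x * p' s))
        (K := 2 * C * C) (x := x) (by positivity)
        (fun s => (dφ s).sub (((dqh s).const_mul _).add ((dp s).const_mul _)))
        (fun s => by
          have e : (u s * qh' s + v s * p' s) - (u x * qh' s + v x * p' s) =
            (u s - u x) * qh' s + (v s - v x) * p' s := by ring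
          rw [e, Real.norm_eq_abs]
          refine (abs_add_le _ _).trans ?_
          rw [abs_mul, abs_mul]
          have e1 := mul_le_mul (lu x s) (bqh' s) (abs_nonneg _) (by positivity)
          have e2 := mul_le_mul (lv x s) (bp' s) (abs_nonneg _) (by positivity)
          linarith) y
      have e : φ y - φ x - inner ℝ (D x) (Γ y - Γ x) =
          φ y - (u x * qh y + v x * p y) - (φ x - (u x * qh x + v x * p x)) := by
        simp only [hΓ]
        rw [← map_sub, inner_toEuclid]
        simp [hD, toEuclid_apply]
        ring
      rw [e]
      calc _ ≤ 2 * C * C * |y - x| ^ 2 := h1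
        _ ≤ 2 * C * C * (2 / c * ‖Γ y - Γ x‖) ^ 2 := by gcongr; exact hΓlow' x y
        _ = 2 * C * C * (4 / c ^ 2) * ‖Γ y - Γ x‖ ^ 2 := by ring
        _ ≤ _ := by
          gcongr
          have : 0 < 4 * C / c := by positivity
          have : 0 < C * C := by positivity
          linarith)
    (fun x => by
      simp only [hΓ]
      rw [← map_add, perqh, perp, perz]
      simp)
    (fun x => by simp only [hφ, perqh, perp, perz, perzh, perq]; ring)
    (fun x => by
      simp only [hD, hu, hv, perqh, perp, perph, perq, add_sub_add_right_eq_sub])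
  have happ : ∀ w i, |g w i| ≤ B := fun w i => (PiLp.norm_apply_le (g w) i).trans (hgb w)
  have hgc : Continuous g := by
    refine continuous_iff_continuousAt.2 fun w => ?_
    exact (LipschitzWith.of_dist_le_mul (K := ⟨B, hB.le⟩) fun a b => by
      rw [dist_eq_norm, dist_eq_norm]; exact hgl a b).continuous.continuousAt
  have hci : ∀ i : Fin 3, Continuous fun a => δ * g (toEuclid a) i := fun i => by fun_prop
  have hbi : ∀ (i : Fin 3) a, |δ * g (toEuclid a) i| ≤ δ * B := fun i a => by
    rw [abs_mul, abs_of_pos hδ]; gcongr; exact happ _ i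
  refine ⟨fun a => δ * H (toEuclid a), fun a => δ * g (toEuclid a) 0, fun a => δ * g (toEuclid a) 1,
    fun a => δ * g (toEuclid a) 2, fun a => ?_, hci 0, hci 1, hci 2, hbi 0, hbi 1, hbi 2,
    fun a => mul_le_mul_of_nonneg_left (hHl _) hδ.le,
    fun a => mul_le_mul_of_nonneg_left (hHu _) hδ.le, fun Q η Z => ?_, ?_⟩
  · have h1 := ((hgrad (toEuclid a)).hasFDerivAt.comp a toEuclid.hasFDerivAt).const_mul δ
    refine h1.congr_fderiv ?_
    ext <;> simp [partialsCLM, inner_toEuclid]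
  · have : toEuclid (Q + 1, η, Z) = toEuclid (Q, η, Z) + toEuclid (1, 0, 0) := by
      rw [← map_add]; simp
    simp only [this, hHper]
  · intro x η Q h1 h2
    have hgx : g (toEuclid (qh x, p x, z x)) = D x := hgΓ x
    have e0 : D x 0 = u x := rfl
    have e1 : D x 1 = v x := rfl
    have e2 : D x 2 = 0 := rfl
    set Δ := toEuclid (Q, η, z x) - toEuclid (qh x, p x, z x) with hΔ
    have hcomp : ∀ i, |g (toEuclid (Q, η, z x)) i - D x i| ≤ B * ‖Δ‖ := fun i => by
      rw [← hgx]
      exact (PiLp.norm_apply_le (g _ - g _) i).trans (hgl _ _)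
    have a1 : |Q - qh x| ≤ δ * (B * ‖Δ‖) := by
      have e : Q - qh x = -(δ * (g (toEuclid (Q, η, z x)) 1 - D x 1)) := by
        rw [e1, hv]; simp only; field_simp; linarith
      rw [e, abs_neg, abs_mul, abs_of_pos hδ]
      gcongr
      exact hcomp 1
    have a2 : |η - p x| ≤ δ * (B * ‖Δ‖) * C := by
      have e : η - p x = δ * (g (toEuclid (Q, η, z x)) 2 - D x 2) * p x := by
        rw [e2]; linarith
      rw [e, abs_mul, abs_mul, abs_of_pos hδ]
      have := hcomp 2
      have := bpC x
      gcongr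
    have a3 : ‖Δ‖ ≤ |Q - qh x| + |η - p x| := by
      rw [hΔ, ← map_sub]
      refine (norm_toEuclid_le _).trans (by simp)
    have a4 : ‖Δ‖ ≤ δ * B * (1 + C) * ‖Δ‖ := by linarith
    have a5 : ‖Δ‖ = 0 := by
      by_contra hne
      have := (norm_nonneg Δ).lt_of_ne' hne
      nlinarith
    rw [a5] at a1 a2
    have b1 : Q = qh x := by
      have : |Q - qh x| ≤ 0 := by simpa using a1
      linarith [abs_nonpos_iff.1 this]
    have b2 : η = p x := by
      have : |η - p x| ≤ 0 := by simpa using a2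
      linarith [abs_nonpos_iff.1 this]
    subst b2 b1
    refine ⟨rfl, ?_, ?_⟩
    · simp only [hgx, e0, hu]; field_simp; ring
    · have := hHΓ x
      simp only [hΓ, hφ] at this
      simp only [this]; field_simp; ring

end Link

section Normalized

lemma abs_comp_le_norm (a : ℝ × ℝ × ℝ) : |a.1| ≤ ‖a‖ ∧ |a.2.1| ≤ ‖a‖ ∧ |a.2.2| ≤ ‖a‖ :=
  ⟨norm_fst_le a, (norm_fst_le a.2).trans (norm_snd_le a), (norm_snd_le a.2).trans (norm_snd_le a)⟩

lemma HasDerivAt.components {f : ℝ → ℝ × ℝ × ℝ} {f' : ℝ × ℝ × ℝ} {x : ℝ} (h : HasDerivAt f f' x) :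
    HasDerivAt (fun y => (f y).1) f'.1 x ∧ HasDerivAt (fun y => (f y).2.1) f'.2.1 x ∧
      HasDerivAt (fun y => (f y).2.2) f'.2.2 x :=
  ⟨((ContinuousLinearMap.fst ℝ ℝ (ℝ × ℝ)).hasFDerivAt (x := f x)).comp_hasDerivAt x h,
    (((ContinuousLinearMap.fst ℝ ℝ ℝ).comp
      (ContinuousLinearMap.snd ℝ ℝ (ℝ × ℝ))).hasFDerivAt (x := f x)).comp_hasDerivAt x h,
    (((ContinuousLinearMap.snd ℝ ℝ ℝ).comp
      (ContinuousLinearMap.snd ℝ ℝ (ℝ × ℝ))).hasFDerivAt (x := f x)).comp_hasDerivAt x h⟩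

/-- A uniformly positive Legendrian isotopy starting at the zero section cannot end below it. -/
theorem false_of_positive_isotopy {q p z : ℝ → ℝ → ℝ}
    (hs : ContDiffOn ℝ 2 (fun w : ℝ × ℝ => (q w.1 w.2, p w.1 w.2, z w.1 w.2)) strip)
    (hper : ∀ t ∈ Icc (0 : ℝ) 1, ∀ x : ℝ,
      q t (x + 1) = q t x + 1 ∧ p t (x + 1) = p t x ∧ z t (x + 1) = z t x)
    (himm : ∀ t ∈ Icc (0 : ℝ) 1, ∀ x : ℝ,
      (deriv (q t) x, deriv (p t) x, deriv (z t) x) ≠ ((0 : ℝ), (0 : ℝ), (0 : ℝ)))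
    (hinj : ∀ t ∈ Icc (0 : ℝ) 1, ∀ x y : ℝ, ∀ k : ℤ,
      q t x = q t y + k → p t x = p t y → z t x = z t y → ∃ m : ℤ, x - y = (m : ℝ))
    (hleg : ∀ t ∈ Icc (0 : ℝ) 1, ∀ x : ℝ, deriv (z t) x = p t x * deriv (q t) x)
    {h : ℝ} (hh : 0 < h)
    (hpos : ∀ t ∈ Ioo (0 : ℝ) 1, ∀ x : ℝ,
      h ≤ deriv (fun τ => z τ x) t - p t x * deriv (fun τ => q τ x) t)
    (hinit : ∀ x : ℝ, q 0 x = x ∧ p 0 x = 0 ∧ z 0 x = 0)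
    (hfin : ∀ x, z 1 x ≤ 0) : False := by
  set w : ℝ × ℝ → ℝ × ℝ × ℝ := fun w => (q w.1 w.2, p w.1 w.2, z w.1 w.2) with hw
  have hwper : ∀ t ∈ Icc (0 : ℝ) 1, ∀ x, w (t, x + 1) = w (t, x) + (1, 0, 0) := fun t ht x => by
    simp [hw, hper t ht x]
  obtain ⟨w', hw's, hw'per, hw'd⟩ := exists_hasDerivAt_strip hs hwper
  obtain ⟨C₁, hC₁, hl₁⟩ := exists_lipschitz_strip (hs.of_le one_le_two) hwper
  obtain ⟨C₂, hC₂, hl₂⟩ := exists_lipschitz_strip (k := 0) hw's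
    (fun t ht x => by rw [hw'per t ht, add_zero])
  set C : ℝ := C₁ + C₂ + 1 with hCdef
  have hC : 0 < C := by positivity
  have hl : ∀ a ∈ strip, ∀ b ∈ strip, ‖w b - w a‖ ≤ C * ‖b - a‖ := fun a ha b hb =>
    (hl₁ a ha b hb).trans (by gcongr; linarith)
  have hl' : ∀ a ∈ strip, ∀ b ∈ strip, ‖w' b - w' a‖ ≤ C * ‖b - a‖ := fun a ha b hb =>
    (hl₂ a ha b hb).trans (by gcongr; linarith)
  have mem : ∀ {t}, t ∈ Icc (0 : ℝ) 1 → ∀ x : ℝ, ((t, x) : ℝ × ℝ) ∈ strip :=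
    fun ht x => ⟨ht, mem_univ _⟩
  have nt : ∀ t s x : ℝ, ‖((t, x) : ℝ × ℝ) - (s, x)‖ = |t - s| := fun t s x => by
    simp [Prod.norm_def]
  have nx : ∀ t x y : ℝ, ‖((t, x) : ℝ × ℝ) - (t, y)‖ = |x - y| := fun t x y => by
    simp [Prod.norm_def]
  have zero_mem : (0 : ℝ) ∈ Icc (0 : ℝ) 1 := by simp
  have lt : ∀ t ∈ Icc (0 : ℝ) 1, ∀ s ∈ Icc (0 : ℝ) 1, ∀ x, ‖w (s, x) - w (t, x)‖ ≤ C * |s - t| :=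
    fun t ht s hs x => by rw [← nt s t x]; exact hl _ (mem ht x) _ (mem hs x)
  have lt' : ∀ t ∈ Icc (0 : ℝ) 1, ∀ s ∈ Icc (0 : ℝ) 1, ∀ x,
      ‖w' (s, x) - w' (t, x)‖ ≤ C * |s - t| :=
    fun t ht s hs x => by rw [← nt s t x]; exact hl' _ (mem ht x) _ (mem hs x)
  have b0 : ∀ t ∈ Icc (0 : ℝ) 1, ∀ x, ‖w (t, x) - w (0, x)‖ ≤ C := fun t ht x => by
    refine (lt 0 zero_mem t ht x).trans ?_
    rw [sub_zero, abs_of_nonneg ht.1]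
    nlinarith [ht.2]
  have hw'b : ∀ t ∈ Icc (0 : ℝ) 1, ∀ x, ‖w' (t, x)‖ ≤ C := fun t ht x =>
    (hw'd t ht x).le_of_lip' hC.le (Eventually.of_forall fun y => by
      rw [Real.norm_eq_abs, ← nx t y x]; exact hl _ (mem ht x) _ (mem ht y))
  have hleg' : ∀ t ∈ Icc (0 : ℝ) 1, ∀ x, (w' (t, x)).2.2 = p t x * (w' (t, x)).1 :=
    fun t ht x => by
    have h1 := hleg t ht x
    have h2 := (hw'd t ht x).components
    rwa [h2.1.deriv, h2.2.2.deriv] at h1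
  obtain ⟨c, hc, hclow⟩ := exists_bilipschitz hs.continuousOn hw's.continuousOn hwper hw'per hw'd
    (fun t ht x h0 => himm t ht x (by
      have h2 := (hw'd t ht x).components
      have e1 := h2.1.deriv
      have e2 := h2.2.1.deriv
      have e3 := h2.2.2.deriv
      rw [h0] at e1 e2 e3
      simp only [Prod.mk.injEq]
      exact ⟨e1, e2, e3⟩))
    (fun t ht x y hxy => by
      simp only [hw, Prod.mk.injEq] at hxy
      obtain ⟨m, hm⟩ := hinj t ht x y 0 (by simpa using hxy.1) hxy.2.1 hxy.2.2
      have hit : ∀ n : ℕ, ∀ y, q t (y + n) = q t y + n := fun n => by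
        induction n with
        | zero => simp
        | succ n ih => intro y; push_cast; rw [← add_assoc, (hper t ht _).1, ih, add_assoc]
      have h3 : q t x = q t y + m := by
        have ex : x = y + m := by linarith
        rcases Int.eq_nat_or_neg m with ⟨n, rfl | rfl⟩
        · rw [ex]; simpa using hit n y
        · have := hit n x
          rw [ex] at this ⊢
          push_cast at this ⊢
          rw [neg_add_cancel_right] at this
          linarith
      have : (m : ℝ) = 0 := by linarith [hxy.1]
      linarith)
    hC.le (fun t ht x y => by rw [← nx t y x]; exact hl' _ (mem ht x) _ (mem ht y))
    (fun t ht x => by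
      have h1 := (abs_comp_le_norm (w (t, x) - w (0, x))).1.trans (b0 t ht x)
      simpa [hw, (hinit x).1] using h1)
  obtain ⟨B, hB, hlink⟩ := exists_link (half_pos hh) hC hc
  obtain ⟨N, hN⟩ := exists_nat_gt (2 * C / c + B * (1 + C) + 2 * C * C / h + 2 * B)
  have t1 : 0 < 2 * C / c := by positivity
  have t2 : 0 < B * (1 + C) := by positivity
  have t3 : 0 < 2 * C * C / h := by positivity
  have hN0 : (0 : ℝ) < N := by linarith
  have hNpos : 0 < N := by exact_mod_cast hN0
  set δ : ℝ := 1 / N with hδ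
  have hδ0 : 0 < δ := by positivity
  have d1 : C * δ ≤ c / 2 := by
    have : 2 * C / c < N := by linarith
    rw [div_lt_iff₀ hc] at this
    rw [hδ, mul_one_div, div_le_iff₀ hN0]; linarith
  have d2 : δ * B * (1 + C) < 1 := by
    rw [hδ, mul_assoc, one_div_mul_eq_div, div_lt_one hN0]; linarith
  have d3 : C * C * δ ≤ h / 2 := by
    have : 2 * C * C / h < N := by linarith
    rw [div_lt_iff₀ hh] at this
    rw [hδ, mul_one_div, div_le_iff₀ hN0]; linarith
  have d4 : δ * B ≤ 1 / 2 := by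
    rw [hδ, one_div_mul_eq_div, div_le_iff₀ hN0]; linarith
  have hposstep : ∀ t ∈ Icc (0 : ℝ) 1, t + δ ∈ Icc (0 : ℝ) 1 → ∀ x,
      h / 2 * δ ≤ z (t + δ) x - z t x - p t x * (q (t + δ) x - q t x) := by
    intro t ht ht' x
    have hsub : Icc t (t + δ) ⊆ Icc 0 1 := Icc_subset_Icc ht.1 ht'.2
    have hcont : ContinuousOn (fun s => w (s, x)) (Icc t (t + δ)) :=
      hs.continuousOn.comp (by fun_prop) fun s hs => mem (hsub hs) x
    have hder : ∀ s ∈ Ioo t (t + δ), ∃ d, HasDerivAt (fun s => w (s, x)) d s ∧ ‖d‖ ≤ C := by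
      intro s hs'
      have hn : strip ∈ 𝓝 ((s, x) : ℝ × ℝ) := by
        rw [nhds_prod_eq]
        exact prod_mem_prod (Icc_mem_nhds (ht.1.trans_lt hs'.1) (hs'.2.trans_le ht'.2)) univ_mem
      have h1 := ((hs.differentiableOn two_ne_zero).differentiableAt hn).hasFDerivAt
      have h2 : HasDerivAt (fun s : ℝ => ((s, x) : ℝ × ℝ)) (1, 0) s :=
        (hasDerivAt_id s).prodMk (hasDerivAt_const s x)
      have h3 := HasFDerivAt.comp_hasDerivAt (f := fun s : ℝ => ((s, x) : ℝ × ℝ)) s h1 h2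
      refine ⟨_, h3, h3.le_of_lip' hC.le ?_⟩
      filter_upwards [Ioo_mem_nhds hs'.1 hs'.2] with r hr
      exact lt s (hsub (Ioo_subset_Icc_self hs')) r (hsub (Ioo_subset_Icc_self hr)) x
    have hψ : ∀ s ∈ Ioo t (t + δ), ∃ d, HasDerivAt (fun s => z s x - p t x * q s x) d s ∧
        h / 2 ≤ d := by
      intro s hs'
      obtain ⟨d, hd, hdC⟩ := hder s hs'
      have h2 := hd.components
      refine ⟨d.2.2 - p t x * d.1, h2.2.2.sub (h2.1.const_mul _), ?_⟩
      have h3 := hpos s ⟨ht.1.trans_lt hs'.1, hs'.2.trans_le ht'.2⟩ x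
      rw [h2.2.2.deriv, h2.1.deriv] at h3
      have h4 : |p s x - p t x| ≤ C * δ := by
        refine (abs_comp_le_norm (w (s, x) - w (t, x))).2.1.trans ?_
        refine (lt t ht s (hsub (Ioo_subset_Icc_self hs')) x).trans ?_
        gcongr
        rw [abs_of_pos (sub_pos.2 hs'.1)]
        linarith [hs'.2]
      have h5 : |(p s x - p t x) * d.1| ≤ C * δ * C := by
        rw [abs_mul]
        exact mul_le_mul h4 ((abs_comp_le_norm d).1.trans hdC) (abs_nonneg _) (by positivity)
      have := (abs_le.1 h5).1
      nlinarith
    have := (convex_Icc t (t + δ)).mul_sub_le_image_sub_of_le_deriv (C := h / 2)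
      (f := fun s => z s x - p t x * q s x)
      (by
        have e1 : ContinuousOn (fun s => z s x) (Icc t (t + δ)) := hcont.snd.snd
        have e2 : ContinuousOn (fun s => q s x) (Icc t (t + δ)) := hcont.fst
        fun_prop)
      (fun s hs' => by
        rw [interior_Icc] at hs'
        obtain ⟨d, hd, -⟩ := hψ s hs'
        exact hd.differentiableAt.differentiableWithinAt)
      (fun s hs' => by
        rw [interior_Icc] at hs'
        obtain ⟨d, hd, hd2⟩ := hψ s hs'
        rwa [hd.deriv])
      t (by simp [hδ0.le]) (t + δ) (by simp [hδ0.le]) (by linarith)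
    simp only [add_sub_cancel_left] at this
    linarith
  have hstep := fun (t : ℝ) (ht : t ∈ Icc (0 : ℝ) 1) (ht' : t + δ ∈ Icc (0 : ℝ) 1) =>
    have e : |t + δ - t| = δ := by rw [add_sub_cancel_left, abs_of_pos hδ0]
    have k := fun x => abs_comp_le_norm (w (t + δ, x) - w (t, x))
    have k' := fun x => abs_comp_le_norm (w' (t + δ, x) - w' (t, x))
    have lk := fun x => (lt t ht _ ht' x).trans_eq (by rw [e])
    have lk' := fun x => (lt' t ht _ ht' x).trans_eq (by rw [e])
    hlink δ hδ0 d1 d2 (q t) (p t) (z t) (q (t + δ)) (p (t + δ)) (z (t + δ))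
      (fun x => (w' (t, x)).1) (fun x => (w' (t, x)).2.1) (fun x => (w' (t + δ, x)).1)
      (fun x => (w' (t + δ, x)).2.1)
      (fun x => (hw'd t ht x).components.1) (fun x => (hw'd t ht x).components.2.1)
      (fun x => (hw'd t ht x).components.2.2.congr_deriv (hleg' t ht x))
      (fun x => (hw'd _ ht' x).components.1) (fun x => (hw'd _ ht' x).components.2.1)
      (fun x => (hw'd _ ht' x).components.2.2.congr_deriv (hleg' _ ht' x))
      (fun x => (abs_comp_le_norm _).2.1.trans (hw'b t ht x))
      (fun x => (abs_comp_le_norm _).1.trans (hw'b _ ht' x))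
      (fun x => (k' x).1.trans (lk' x)) (fun x => (k' x).2.1.trans (lk' x))
      (fun x => (k x).1.trans (lk x)) (fun x => (k x).2.1.trans (lk x))
      (fun x => (k x).2.2.trans (lk x))
      (fun x => by
        have h1 := (abs_comp_le_norm (w (t, x) - w (0, x))).2.1.trans (b0 t ht x)
        simpa [hw, (hinit x).2.1] using h1)
      (hposstep t ht ht') (hclow t ht)
      (fun x => (hper t ht x).1) (fun x => (hper t ht x).2.1) (fun x => (hper t ht x).2.2)
      (fun x => (hper _ ht' x).1) (fun x => (hper _ ht' x).2.1) (fun x => (hper _ ht' x).2.2)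
  have htime : ∀ i : ℕ, i < N → (i : ℝ) / N ∈ Icc (0 : ℝ) 1 ∧ (i : ℝ) / N + δ ∈ Icc (0 : ℝ) 1 ∧
      (i : ℝ) / N + δ = ((i + 1 : ℕ) : ℝ) / N := by
    intro i hi
    have hi' : ((i : ℝ) + 1) ≤ N := by exact_mod_cast hi
    have e : (i : ℝ) / N + δ = ((i + 1 : ℕ) : ℝ) / N := by rw [hδ, ← add_div]; push_cast; rfl
    refine ⟨⟨by positivity, ?_⟩, ?_, e⟩
    · rw [div_le_one hN0]; linarith
    · rw [e]
      refine ⟨by positivity, ?_⟩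
      rw [div_le_one hN0]; push_cast; exact hi'
  have hidx : ∀ i, min i (N - 1) < N := fun i => by omega
  choose G GQ Gη GZ hG hcQ hcη hcZ hbQ hbη hbZ hGl hGu hGper hGstep using fun i : ℕ =>
    hstep ((min i (N - 1) : ℕ) / N) (htime _ (hidx i)).1 (htime _ (hidx i)).2.1
  refine false_of_generating_chain hNpos hG hcQ hcη hcZ (fun i a => (hbQ i a).trans d4)
    (fun i a => (hbη i a).trans d4) (fun i a => (hbZ i a).trans d4)
    (l := δ * exp (-B)) (u := δ * B) (by positivity) hGl hGu hGper
    (fun i Q P Z => ∃ x, Q = q (i / N) x ∧ P = p (i / N) x ∧ Z = z (i / N) x) ?_ ?_ ?_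
  · intro x
    refine ⟨x, ?_⟩
    simp [hinit x]
  · rintro i hi Q₀ P Z η Q ⟨x, rfl, rfl, rfl⟩ h1 h2
    have hmin : min i (N - 1) = i := by omega
    have key := hGstep i x η Q
    rw [hmin, (htime i hi).2.2] at key
    obtain ⟨k1, k2, k3⟩ := key h1 h2
    exact ⟨x, k1, k2, k3⟩
  · rintro Q P Z ⟨x, -, -, rfl⟩
    rw [div_self hN0.ne']
    exact hfin x

end Normalized

section Reduction

lemma hasDerivAt_fst_strip {X : Type*} [NormedAddCommGroup X] [NormedSpace ℝ X] {g : ℝ × ℝ → X}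
    (hg : DifferentiableOn ℝ g strip) {t : ℝ} (ht : t ∈ Ioo (0 : ℝ) 1) (x : ℝ) :
    HasDerivAt (fun s => g (s, x)) (fderivWithin ℝ g strip (t, x) (1, 0)) t := by
  have hn : strip ∈ 𝓝 ((t, x) : ℝ × ℝ) := by
    rw [nhds_prod_eq]
    exact prod_mem_prod (Icc_mem_nhds ht.1 ht.2) univ_mem
  have h1 := (hg (t, x) (mem_of_mem_nhds hn)).hasFDerivWithinAt.hasFDerivAt hn
  have h2 : HasDerivAt (fun s : ℝ => ((s, x) : ℝ × ℝ)) (1, 0) t :=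
    (hasDerivAt_id t).prodMk (hasDerivAt_const t x)
  exact HasFDerivAt.comp_hasDerivAt (f := fun s : ℝ => ((s, x) : ℝ × ℝ)) t h1 h2

/-- Positivity is uniform on compact subintervals of `(0,1)`. -/
lemma exists_uniform_positivity {q p z : ℝ → ℝ → ℝ}
    (hs : ContDiffOn ℝ 1 (fun w : ℝ × ℝ => (q w.1 w.2, p w.1 w.2, z w.1 w.2)) strip)
    (hper : ∀ t ∈ Icc (0 : ℝ) 1, ∀ x : ℝ,
      q t (x + 1) = q t x + 1 ∧ p t (x + 1) = p t x ∧ z t (x + 1) = z t x)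
    (hpos : ∀ t ∈ Icc (0 : ℝ) 1, ∀ x : ℝ,
      0 < deriv (fun τ => z τ x) t - p t x * deriv (fun τ => q τ x) t)
    {a b : ℝ} (ha : 0 < a) (hab : a ≤ b) (hb : b < 1) :
    ∃ m > 0, ∀ t ∈ Icc a b, ∀ x,
      m ≤ deriv (fun τ => z τ x) t - p t x * deriv (fun τ => q τ x) t := by
  set w : ℝ × ℝ → ℝ × ℝ × ℝ := fun w => (q w.1 w.2, p w.1 w.2, z w.1 w.2) with hw
  have hwper : ∀ t ∈ Icc (0 : ℝ) 1, ∀ x, w (t, x + 1) = w (t, x) + (1, 0, 0) := fun t ht x => by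
    simp [hw, hper t ht x]
  have hsub : Icc a b ⊆ Icc 0 1 := Icc_subset_Icc ha.le hb.le
  set d : ℝ × ℝ → ℝ × ℝ × ℝ := fun v => fderivWithin ℝ w strip v (1, 0) with hd
  have hdc : ContinuousOn d strip :=
    (hs.continuousOn_fderivWithin uniqueDiffOn_strip le_rfl).clm_apply continuousOn_const
  have hval : ∀ t ∈ Icc a b, ∀ x, deriv (fun τ => z τ x) t - p t x * deriv (fun τ => q τ x) t =
      (d (t, x)).2.2 - (w (t, x)).2.1 * (d (t, x)).1 := fun t ht x => by
    have h1 := (hasDerivAt_fst_strip (hs.differentiableOn one_ne_zero)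
      ⟨ha.trans_le ht.1, ht.2.trans_lt hb⟩ x).components
    rw [h1.1.deriv, h1.2.2.deriv]
  have hcont : ContinuousOn (fun v => (d v).2.2 - (w v).2.1 * (d v).1) (Icc a b ×ˢ Icc (0 : ℝ) 1) :=
    ContinuousOn.mono (hdc.snd.snd.sub (hs.continuousOn.snd.fst.mul hdc.fst))
      (prod_mono hsub (subset_univ _))
  obtain ⟨v, hv, hmin⟩ := (isCompact_Icc.prod isCompact_Icc).exists_isMinOn
    ⟨(a, 0), by simp [hab]⟩ hcont
  refine ⟨(d v).2.2 - (w v).2.1 * (d v).1, ?_, fun t ht x => ?_⟩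
  · exact (hval v.1 hv.1 v.2) ▸ hpos v.1 (hsub hv.1) v.2
  · rw [hval t ht x]
    have hp : Function.Periodic (fun x => (d (t, x)).2.2 - (w (t, x)).2.1 * (d (t, x)).1) 1 :=
      fun x => by
        simp only [hd]
        rw [fderivWithin_strip_add_one (hs.differentiableOn one_ne_zero) hwper (hsub ht) x,
          hwper t (hsub ht)]
        simp
    obtain ⟨y, hy, hxy⟩ := hp.exists_mem_Ico₀ one_pos x
    rw [hxy]
    exact hmin (show (t, y) ∈ Icc a b ×ˢ Icc (0 : ℝ) 1 from ⟨ht, Ico_subset_Icc_self hy⟩)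

end Reduction

/-- Colin–Ferrand–Pushkar for `N = S¹`: there is no positive Legendrian loop in `J¹(S¹)`
based at the 1-jet extension of a function.  `J¹(S¹)` is modelled as `ℝ³` (coordinates
`(q,p,z)`, contact form `dz − p dq`) with the ℤ-action `k•(q,p,z) = (q+k,p,z)`. -/
theorem no_positive_loop_of_one_jets (F : ℝ → ℝ)
    (hF : ContDiff ℝ (⊤ : ℕ∞) F) (hFper : ∀ x : ℝ, F (x + 1) = F x)
    (q p z : ℝ → ℝ → ℝ)
    (hsmooth : ContDiffOn ℝ (⊤ : ℕ∞)
      (fun w : ℝ × ℝ => (q w.1 w.2, p w.1 w.2, z w.1 w.2))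
      (Set.Icc (0:ℝ) 1 ×ˢ Set.univ))
    -- (a) ℤ-equivariance/periodicity
    (hper : ∀ t ∈ Set.Icc (0:ℝ) 1, ∀ x : ℝ,
      q t (x + 1) = q t x + 1 ∧ p t (x + 1) = p t x ∧ z t (x + 1) = z t x)
    -- (b) each ι_t is an immersion ...
    (himm : ∀ t ∈ Set.Icc (0:ℝ) 1, ∀ x : ℝ,
      (deriv (q t) x, deriv (p t) x, deriv (z t) x) ≠ ((0:ℝ), (0:ℝ), (0:ℝ)))
    -- ... injective modulo the ℤ-action
    (hinj : ∀ t ∈ Set.Icc (0:ℝ) 1, ∀ x y : ℝ, ∀ k : ℤ,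
      q t x = q t y + k → p t x = p t y → z t x = z t y → ∃ m : ℤ, x - y = (m : ℝ))
    -- (c) each ι_t is Legendrian: dz − p dq vanishes along it
    (hleg : ∀ t ∈ Set.Icc (0:ℝ) 1, ∀ x : ℝ, deriv (z t) x = p t x * deriv (q t) x)
    -- (d) the isotopy is positive
    (hpos : ∀ t ∈ Set.Icc (0:ℝ) 1, ∀ x : ℝ,
      0 < deriv (fun τ => z τ x) t - p t x * deriv (fun τ => q τ x) t)
    -- (e) ι₀ is the 1-jet extension of F
    (hinit : ∀ x : ℝ, q 0 x = x ∧ p 0 x = deriv F x ∧ z 0 x = F x) :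
    -- conclusion: the images cannot close up modulo the ℤ-action
    ¬ ({w : ℝ × ℝ × ℝ | ∃ x : ℝ, ∃ k : ℤ, w = (q 1 x + k, p 1 x, z 1 x)} =
        {w : ℝ × ℝ × ℝ | ∃ y : ℝ, ∃ k : ℤ, w = (y + k, deriv F y, F y)}) := by
  intro hloop
  have hs2 : ContDiffOn ℝ 2 (fun w : ℝ × ℝ => (q w.1 w.2, p w.1 w.2, z w.1 w.2)) strip :=
    hsmooth.of_le (by norm_cast)
  have hwper : ∀ t ∈ Icc (0 : ℝ) 1, ∀ x, (q t (x + 1), p t (x + 1), z t (x + 1)) =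
      (q t x, p t x, z t x) + ((1, 0, 0) : ℝ × ℝ × ℝ) := fun t ht x => by simp [hper t ht x]
  obtain ⟨w', -, -, hw'⟩ := exists_hasDerivAt_strip hs2 hwper
  obtain ⟨m, hm, hmin⟩ := exists_uniform_positivity (hs2.of_le one_le_two) hper hpos
    (a := 1 / 5) (b := 4 / 5) (by norm_num) (by norm_num) (by norm_num)
  have hF' : ContDiff ℝ 2 (deriv F) := by
    have h3 : ContDiff ℝ (2 + 1) F := hF.of_le (by norm_cast)
    exact h3.deriv'
  have dF : ∀ x, HasDerivAt F (deriv F x) x := fun x =>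
    (hF.differentiable (by simp) x).hasDerivAt
  have dF' : ∀ x, HasDerivAt (deriv F) (deriv (deriv F) x) x := fun x =>
    (hF'.differentiable two_ne_zero x).hasDerivAt
  have hF'per : ∀ x, deriv F (x + 1) = deriv F x := fun x => by
    rw [← deriv_comp_add_const]
    simp_rw [hFper]
  have hFint : ∀ x (k : ℤ), F (x + k) = F x := fun x k => by
    simpa using Function.Periodic.int_mul hFper k x
  have hF'int : ∀ x (k : ℤ), deriv F (x + k) = deriv F x := fun x k => by
    simpa using Function.Periodic.int_mul hF'per k x
  set κ : ℝ → ℝ := fun t => 6 * m * ((t - 1 / 2) ^ 3 / 3 - (t - 1 / 2) / 12) with hκ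
  have dκ : ∀ t, HasDerivAt κ (6 * m * ((t - 1 / 2) ^ 2 - 1 / 12)) t := fun t => by
    have h1 := (hasDerivAt_id t).sub_const (1 / 2)
    have h2 := (((h1.pow 3).div_const 3).sub (h1.div_const 12)).const_mul (6 * m)
    refine h2.congr_deriv ?_
    simp
  have dP : ∀ t ∈ Icc (0 : ℝ) 1, ∀ x, HasDerivAt (fun x => p t x - deriv F (q t x))
      (deriv (p t) x - deriv (deriv F) (q t x) * deriv (q t) x) x := fun t ht x => by
    have h := (hw' t ht x).components
    refine (h.2.1.sub ((dF' (q t x)).comp x h.1)).congr_deriv ?_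
    rw [h.1.deriv, h.2.1.deriv]
  have dZ : ∀ t ∈ Icc (0 : ℝ) 1, ∀ x, HasDerivAt (fun x => z t x - F (q t x) + κ t)
      (deriv (z t) x - deriv F (q t x) * deriv (q t) x) x := fun t ht x => by
    have h := (hw' t ht x).components
    refine ((h.2.2.sub ((dF (q t x)).comp x h.1)).add_const _).congr_deriv ?_
    rw [h.1.deriv, h.2.2.deriv]
  refine false_of_positive_isotopy (q := q) (p := fun t x => p t x - deriv F (q t x))
    (z := fun t x => z t x - F (q t x) + κ t) (h := m / 25) ?_ ?_ ?_ ?_ ?_ (by positivity) ?_ ?_ ?_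
  · have hq : ContDiffOn ℝ 2 (fun w : ℝ × ℝ => q w.1 w.2) strip := hs2.fst
    have hp : ContDiffOn ℝ 2 (fun w : ℝ × ℝ => p w.1 w.2) strip := hs2.snd.fst
    have hz : ContDiffOn ℝ 2 (fun w : ℝ × ℝ => z w.1 w.2) strip := hs2.snd.snd
    refine hq.prodMk ((hp.sub (hF'.comp_contDiffOn hq)).prodMk
      ((hz.sub ((hF.of_le (by norm_cast)).comp_contDiffOn hq)).add ?_))
    refine ContDiff.contDiffOn ?_
    simp only [hκ]
    fun_prop
  · intro t ht x
    obtain ⟨h1, h2, h3⟩ := hper t ht x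
    simp only [h1, h2, h3, hFper, hF'per, and_self]
  · intro t ht x h0
    simp only [Prod.mk.injEq] at h0
    rw [(dP t ht x).deriv, (dZ t ht x).deriv] at h0
    obtain ⟨h1, h2, h3⟩ := h0
    rw [h1, mul_zero, sub_zero] at h2 h3
    exact himm t ht x (by rw [h1, h2, h3])
  · intro t ht x y k hq hp hz
    rw [hq, hF'int] at hp
    rw [hq, hFint] at hz
    exact hinj t ht x y k hq (by linarith) (by linarith)
  · intro t ht x
    rw [(dZ t ht x).deriv, hleg t ht x]
    ring
  · intro t ht x
    have h := (hasDerivAt_fst_strip (hs2.differentiableOn two_ne_zero) ht x).components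
    have hZ := ((h.2.2.sub ((dF (q t x)).comp t h.1)).add (dκ t)).deriv
    have hZ' : deriv (fun τ => z τ x - F (q τ x) + κ τ) t = deriv (fun τ => z τ x) t -
        deriv F (q t x) * deriv (fun τ => q τ x) t + 6 * m * ((t - 1 / 2) ^ 2 - 1 / 12) := by
      rw [h.1.deriv, h.2.2.deriv]; exact hZ
    rw [hZ']
    have h0 := hpos t (Ioo_subset_Icc_self ht) x
    by_cases hmid : t ∈ Icc (1 / 5 : ℝ) (4 / 5)
    · have h1 := hmin t hmid x
      nlinarith [mul_nonneg hm.le (sq_nonneg (t - 1 / 2))]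
    · have h1 : 9 / 100 ≤ (t - 1 / 2) ^ 2 := by
        by_contra! hlt
        apply hmid
        constructor <;> nlinarith
      nlinarith [mul_le_mul_of_nonneg_left h1 hm.le]
  · intro x
    obtain ⟨h1, h2, h3⟩ := hinit x
    simp only [h1, h2, h3, hκ]
    norm_num
  · intro x
    have hmem : (q 1 x + (0 : ℤ), p 1 x, z 1 x) ∈
        {w : ℝ × ℝ × ℝ | ∃ y : ℝ, ∃ k : ℤ, w = (y + k, deriv F y, F y)} := by
      rw [← hloop]; exact ⟨x, 0, rfl⟩
    obtain ⟨y, k, hy⟩ := hmem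
    simp only [Int.cast_zero, add_zero, Prod.mk.injEq] at hy
    simp only [hy.1, hy.2.2, hFint, hκ]
    norm_num
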